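/- arXiv:1511.04719 — 4 statements merged into one kernel-verified Lean document; each statement's English description precedes it below -/
import Mathlib

section
/- Let F ∈ ℂ[x₀,x₁,y₀,y₁] be a nonzero bihomogeneous polynomial, let H = {F = 0} ⊆ ℙ¹ × ℙ¹, let X, Y be nonempty Zariski-open subsets of ℙ¹, and let t ≥ 1 be an integer. Write F = f(x₀,x₁)·g(y₀,y₁)·h₁^{r₁}·…·h_n^{r_n}, where f and g are homogeneous, h₁, …, h_n are pairwise non-associate irreducible bihomogeneous polynomials each of positive degree in the x-variables and of positive degree in the y-variables, and r₁, …, r_n ≥ 1; let dᵢ denote the degree of hᵢ in the y-variables. Then H ∩ (X × Y) is (1,t)-grid-free if and only if {f = 0} ∩ X = ∅ and |{g = 0} ∩ Y| + d₁ + d₂ + … + d_n < t. -/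
open MvPolynomial

noncomputable section

/-- Points of `ℙⁿ⁻¹` over `ℂ`: nonzero vectors of `ℂⁿ` up to scalar. -/
abbrev Pt (n : ℕ) := Projectivization ℂ (Fin n → ℂ)

/-- Weight function selecting the `x`-variables. -/
def wx (n : ℕ) : Fin n ⊕ Fin n → ℕ := Sum.elim (fun _ => 1) (fun _ => 0)

/-- Weight function selecting the `y`-variables. -/
def wy (n : ℕ) : Fin n ⊕ Fin n → ℕ := Sum.elim (fun _ => 0) (fun _ => 1)

/-- A polynomial in the variables `x₀,…,x_{n-1},y₀,…,y_{n-1}` is bihomogeneous if it is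
homogeneous in the `x`-variables and homogeneous in the `y`-variables. -/
def Bihom {n : ℕ} (F : MvPolynomial (Fin n ⊕ Fin n) ℂ) : Prop :=
  ∃ a b, F.IsWeightedHomogeneous (wx n) a ∧ F.IsWeightedHomogeneous (wy n) b

/-- The degree of `F` in the `x`-variables. -/
def xdeg {n : ℕ} (F : MvPolynomial (Fin n ⊕ Fin n) ℂ) : ℕ :=
  MvPolynomial.weightedTotalDegree (wx n) F

/-- The degree of `F` in the `y`-variables. -/
def ydeg {n : ℕ} (F : MvPolynomial (Fin n ⊕ Fin n) ℂ) : ℕ :=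
  MvPolynomial.weightedTotalDegree (wy n) F

/-- The zero set in `ℙⁿ⁻¹ × ℙⁿ⁻¹` of a bihomogeneous polynomial. -/
def zeroSet {n : ℕ} (F : MvPolynomial (Fin n ⊕ Fin n) ℂ) : Set (Pt n × Pt n) :=
  {p | eval (Sum.elim p.1.rep p.2.rep) F = 0}

/-- A Zariski-open subset of `ℙⁿ⁻¹`: the complement of the common zero set of a finite
family of homogeneous polynomials. -/
def ZarOpen {n : ℕ} (X : Set (Pt n)) : Prop :=
  ∃ S : Finset (MvPolynomial (Fin n) ℂ),
    (∀ g ∈ S, ∃ d, g.IsHomogeneous d) ∧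
    X = {p : Pt n | ¬ ∀ g ∈ S, eval p.rep g = 0}

/-- `V ⊆ P₁ × P₂` is `(s,t)`-grid-free if there are no `S ⊆ P₁`, `T ⊆ P₂` with
`|S| = s`, `|T| = t` and `S × T ⊆ V`. -/
def GridFree {α β : Type*} (s t : ℕ) (V : Set (α × β)) : Prop :=
  ¬ ∃ (S : Finset α) (T : Finset β), S.card = s ∧ T.card = t ∧
      ∀ a ∈ S, ∀ b ∈ T, (a, b) ∈ V

theorem exists_ne_zero_sum_natDegree_le_card_roots {A ι : Type*} [CommRing A] [IsDomain A]
    [UniqueFactorizationMonoid A] [CharZero A] [Fintype ι] (P : ι → Polynomial A)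
    (hirr : ∀ i, Irreducible (P i)) (hdeg : ∀ i, (P i).natDegree ≠ 0)
    (hassoc : ∀ i j, i ≠ j → ¬ Associated (P i) (P j)) :
    ∃ c : A, c ≠ 0 ∧ ∀ φ : A →+* ℂ, φ c ≠ 0 →
      ∑ i, (P i).natDegree ≤ ((∏ i, P i).map φ).roots.toFinset.card ∧ (∏ i, P i).map φ ≠ 0 := by
  classical
  have : NormalizedGCDMonoid A :=
    Classical.choice (inferInstance : Nonempty (NormalizedGCDMonoid A))
  let K := FractionRing A
  have : CharZero K := charZero_of_injective_algebraMap (IsFractionRing.injective A K)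
  have hprim : ∀ i, (P i).IsPrimitive := fun i => (hirr i).isPrimitive (hdeg i)
  have hirrK : ∀ i, Irreducible ((P i).map (algebraMap A K)) := fun i =>
    ((hprim i).irreducible_iff_irreducible_map_fraction_map (K := K)).1 (hirr i)
  have hsep : ((∏ i, P i).map (algebraMap A K)).Separable := by
    rw [Polynomial.map_prod]
    refine Polynomial.separable_prod (fun i j hij => ?_) fun i => (hirrK i).separable
    refine ((hirrK i).coprime_iff_not_dvd).2 fun hd => hassoc i j hij ?_
    exact (hirr i).associated_of_dvd (hirr j)
      (((hprim i).dvd_iff_fraction_map_dvd_fraction_map K).2 hd)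
  obtain ⟨U, V, hUV⟩ := hsep
  obtain ⟨b, hb, hbU⟩ :=
    IsLocalization.integerNormalization_spec (nonZeroDivisors A) U
  obtain ⟨b', hb', hbV⟩ :=
    IsLocalization.integerNormalization_spec (nonZeroDivisors A) V
  set U' := IsLocalization.integerNormalization (nonZeroDivisors A) U
  set V' := IsLocalization.integerNormalization (nonZeroDivisors A) V
  have key : Polynomial.C b' * U' * (∏ i, P i) +
      Polynomial.C b * V' * Polynomial.derivative (∏ i, P i) = Polynomial.C (b * b') := by
    apply Polynomial.map_injective (algebraMap A K) (IsFractionRing.injective A K)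
    have h1 : U'.map (algebraMap A K) = Polynomial.C (algebraMap A K b) * U := by
      rw [hbU, ← Polynomial.smul_eq_C_mul, algebraMap_smul]
    have h2 : V'.map (algebraMap A K) = Polynomial.C (algebraMap A K b') * V := by
      rw [hbV, ← Polynomial.smul_eq_C_mul, algebraMap_smul]
    rw [Polynomial.derivative_map] at hUV
    simp only [Polynomial.map_add, Polynomial.map_mul, h1, h2, Polynomial.map_C, map_mul]
    linear_combination (Polynomial.C (algebraMap A K b) * Polynomial.C (algebraMap A K b')) * hUV
  have hb0 : b ≠ 0 := nonZeroDivisors.ne_zero hb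
  have hb0' : b' ≠ 0 := nonZeroDivisors.ne_zero hb'
  refine ⟨b * b' * (∏ i, P i).leadingCoeff, mul_ne_zero (mul_ne_zero hb0 hb0')
    (Polynomial.leadingCoeff_ne_zero.2 (Finset.prod_ne_zero_iff.2 fun i _ => (hirr i).ne_zero)),
    fun φ hφ => ?_⟩
  rw [map_mul] at hφ
  have hc := left_ne_zero_of_mul hφ
  have hl := right_ne_zero_of_mul hφ
  have hsepφ : ((∏ i, P i).map φ).Separable := by
    have := congrArg (Polynomial.map φ) key
    simp only [Polynomial.map_add, Polynomial.map_mul, ← Polynomial.derivative_map,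
      Polynomial.map_C] at this
    refine ⟨Polynomial.C (φ (b * b'))⁻¹ * (Polynomial.C (φ b') * U'.map φ),
      Polynomial.C (φ (b * b'))⁻¹ * (Polynomial.C (φ b) * V'.map φ), ?_⟩
    have h1 : Polynomial.C (φ (b * b'))⁻¹ * Polynomial.C (φ (b * b')) = 1 := by
      rw [← Polynomial.C_mul, inv_mul_cancel₀ hc, Polynomial.C_1]
    linear_combination Polynomial.C (φ (b * b'))⁻¹ * this + h1
  refine ⟨?_, hsepφ.ne_zero⟩
  rw [Multiset.toFinset_card_of_nodup (Polynomial.nodup_roots hsepφ),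
    ← (IsAlgClosed.splits _).natDegree_eq_card_roots,
    Polynomial.natDegree_map_of_leadingCoeff_ne_zero φ hl,
    Polynomial.natDegree_prod _ _ fun i _ => (hirr i).ne_zero]

theorem MvPolynomial.IsWeightedHomogeneous.aeval_pow_mul {σ S : Type*} [CommRing S] [Algebra ℂ S]
    {w : σ → ℕ} {φ : MvPolynomial σ ℂ} {d : ℕ} (hφ : φ.IsWeightedHomogeneous w d)
    (a : S) (v : σ → S) : aeval (fun k => a ^ w k * v k) φ = a ^ d * aeval v φ := by
  simp only [aeval_def, eval₂_eq, Finset.mul_sum]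
  refine Finset.sum_congr rfl fun m hm => ?_
  have hd := hφ (mem_support_iff.1 hm)
  rw [Finsupp.weight_apply, Finsupp.sum] at hd
  simp only [mul_pow, Finset.prod_mul_distrib, ← pow_mul]
  rw [Finset.prod_pow_eq_pow_sum, ← hd]
  simp only [smul_eq_mul, mul_comm (w _)]
  ring

theorem MvPolynomial.IsWeightedHomogeneous.isHomogeneous_aeval {σ τ : Type*}
    {w : σ → ℕ} {φ : MvPolynomial σ ℂ} {d : ℕ} (hφ : φ.IsWeightedHomogeneous w d)
    (θ : σ → MvPolynomial τ ℂ) (hθ : ∀ k, (θ k).IsHomogeneous (w k)) :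
    (aeval θ φ).IsHomogeneous d := by
  simp only [aeval_def, eval₂_eq]
  refine IsHomogeneous.sum _ _ _ fun m hm => ?_
  have hd := hφ (mem_support_iff.1 hm)
  rw [Finsupp.weight_apply, Finsupp.sum] at hd
  rw [algebraMap_eq, ← zero_add d]
  refine (isHomogeneous_C _ _).mul ?_
  rw [← hd]
  refine IsHomogeneous.prod _ _ _ fun k _ => ?_
  rw [smul_eq_mul, mul_comm]
  exact (hθ k).pow _

/-- The linear form in the variables `i` and `j` that vanishes at `(a, b)`. -/
def linForm {σ : Type*} (i j : σ) (a b : ℂ) : MvPolynomial σ ℂ :=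
  C b * X i - C a * X j

theorem isHomogeneous_linForm {σ : Type*} (i j : σ) (a b : ℂ) :
    (linForm i j a b).IsHomogeneous 1 := by
  simpa [linForm] using ((isHomogeneous_C σ b).mul (isHomogeneous_X ℂ i)).sub
    ((isHomogeneous_C σ a).mul (isHomogeneous_X ℂ j))

theorem linForm_dvd_of_left {σ : Type*} {w : σ → ℕ} {φ : MvPolynomial σ ℂ} {d : ℕ}
    (hφ : φ.IsWeightedHomogeneous w d) {i j : σ} (hi : w i = 1) (hj : w j = 1)
    (hw : ∀ k, k ≠ i → k ≠ j → w k = 0) {a b : ℂ} (ha : a ≠ 0)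
    {θ : σ → MvPolynomial σ ℂ} (hθi : θ i = C a) (hθj : θ j = C b)
    (hθ : ∀ k, k ≠ i → k ≠ j → θ k = X k) (h0 : aeval θ φ = 0) :
    linForm i j a b ∣ φ := by
  set I := Ideal.span {linForm i j a b} with hI
  let π := Ideal.Quotient.mkₐ ℂ I
  have hrel : π (C b) * π (X i) = π (C a) * π (X j) := by
    rw [← map_mul, ← map_mul]
    exact Ideal.Quotient.eq.2 (Ideal.mem_span_singleton_self _)
  have h1 := hφ.aeval_pow_mul (π (X i)) fun k => π (θ k)
  have h2 := hφ.aeval_pow_mul (π (C a)) fun k => π (X k)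
  have h3 : (fun k => π (X i) ^ w k * π (θ k)) = fun k => π (C a) ^ w k * π (X k) := by
    funext k
    by_cases hki : k = i
    · subst hki; rw [hi, hθi]; ring
    · by_cases hkj : k = j
      · subst hkj; rw [hj, hθj]; linear_combination hrel
      · rw [hw k hki hkj, hθ k hki hkj]; simp
  have h4 : aeval (fun k => π (X k)) φ = π φ := by
    rw [← comp_aeval_apply, aeval_X_left_apply]
  have h5 : aeval (fun k => π (θ k)) φ = 0 := by
    rw [← comp_aeval_apply, h0, map_zero]
  rw [h3, h2, h4, h5, mul_zero, ← map_pow, ← map_mul] at h1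
  have h6 : linForm i j a b ∣ C a ^ d * φ :=
    Ideal.mem_span_singleton.1 (Ideal.Quotient.eq_zero_iff_mem.1 h1)
  exact ((((isUnit_iff_ne_zero.2 ha).map (C : ℂ →+* MvPolynomial σ ℂ)).pow d).dvd_mul_left).1 h6

theorem linForm_dvd {σ : Type*} {w : σ → ℕ} {φ : MvPolynomial σ ℂ} {d : ℕ}
    (hφ : φ.IsWeightedHomogeneous w d) {i j : σ} (hi : w i = 1) (hj : w j = 1)
    (hw : ∀ k, k ≠ i → k ≠ j → w k = 0) {a b : ℂ} (hab : a ≠ 0 ∨ b ≠ 0)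
    {θ : σ → MvPolynomial σ ℂ} (hθi : θ i = C a) (hθj : θ j = C b)
    (hθ : ∀ k, k ≠ i → k ≠ j → θ k = X k) (h0 : aeval θ φ = 0) :
    linForm i j a b ∣ φ := by
  rcases hab with ha | hb
  · exact linForm_dvd_of_left hφ hi hj hw ha hθi hθj hθ h0
  · have := linForm_dvd_of_left hφ hj hi (fun k h1 h2 => hw k h2 h1) hb hθj hθi
      (fun k h1 h2 => hθ k h2 h1) h0
    rwa [← neg_dvd, linForm, neg_sub] at this

theorem irreducible_linForm {σ : Type*} {i j : σ} (hij : i ≠ j) {a b : ℂ} (hab : a ≠ 0 ∨ b ≠ 0) :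
    Irreducible (linForm i j a b) := by
  classical
  have h0 : linForm i j a b ≠ 0 := by
    intro h
    have h1 := congrArg (coeff (Finsupp.single i 1)) h
    have h2 := congrArg (coeff (Finsupp.single j 1)) h
    simp [linForm, coeff_C_mul, coeff_X, Finsupp.single_left_inj, hij, hij.symm] at h1 h2
    tauto
  refine irreducible_of_totalDegree_eq_one ((isHomogeneous_linForm i j a b).totalDegree h0) fun x hx => ?_
  rw [isUnit_iff_ne_zero]
  rintro rfl
  exact h0 (MvPolynomial.ext _ _ fun m => by simpa using hx m)

theorem weightedTotalDegree_eq_zero_of_linForm_dvd {σ : Type*} {φ : MvPolynomial σ ℂ}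
    (hφ : Irreducible φ) {i j : σ} (hij : i ≠ j) {a b : ℂ} (hab : a ≠ 0 ∨ b ≠ 0)
    (hd : linForm i j a b ∣ φ) {w : σ → ℕ} (hi : w i = 0) (hj : w j = 0) :
    weightedTotalDegree w φ = 0 := by
  obtain ⟨u, hu⟩ := (irreducible_linForm hij hab).associated_of_dvd hφ hd
  obtain ⟨c, -, hc⟩ := isUnit_iff_eq_C_of_isReduced.1 u.isUnit
  rw [← isWeightedHomogeneous_zero_iff_weightedTotalDegree_eq_zero, ← hu, hc]
  have hX : ∀ k, w k = 0 → ∀ e : ℂ, (C e * X k : MvPolynomial σ ℂ).IsWeightedHomogeneous w 0 := by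
    intro k hk e
    simpa [hk] using (isWeightedHomogeneous_C w e).mul (isWeightedHomogeneous_X ℂ w k)
  simpa [linForm] using ((weightedHomogeneousSubmodule ℂ w 0).sub_mem (hX i hi b) (hX j hj a)
    : (linForm i j a b).IsWeightedHomogeneous w 0).mul (isWeightedHomogeneous_C w c)

theorem Pt.rep_ne_zero (p : Pt 2) : p.rep 0 ≠ 0 ∨ p.rep 1 ≠ 0 := by
  by_contra! hp
  exact p.rep_nonzero (funext fun i => by fin_cases i; exacts [hp.1, hp.2])

theorem Pt.eq_of_det_eq_zero {p q : Pt 2} (h : q.rep 1 * p.rep 0 - q.rep 0 * p.rep 1 = 0) :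
    p = q := by
  rw [← p.mk_rep, ← q.mk_rep, Projectivization.mk_eq_mk_iff']
  by_cases h0 : q.rep 0 = 0
  · have h1 : q.rep 1 ≠ 0 := q.rep_ne_zero.resolve_left (not_not.2 h0)
    have hp : p.rep 0 = 0 := by simpa [h0, h1] using h
    refine ⟨p.rep 1 / q.rep 1, funext fun i => ?_⟩
    fin_cases i
    · simp [h0, hp]
    · simp [h1]
  · refine ⟨p.rep 0 / q.rep 0, funext fun i => ?_⟩
    fin_cases i
    · simp [h0]
    · simp only [Fin.mk_one, Pi.smul_apply, smul_eq_mul]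
      field_simp
      linear_combination h

instance : Infinite (Pt 2) := by
  refine Infinite.of_injective
    (fun z : ℂ => (Projectivization.mk ℂ ![1, z] (fun h => one_ne_zero (congrFun h 0)) : Pt 2))
    fun z z' h => ?_
  obtain ⟨a, ha⟩ := (Projectivization.mk_eq_mk_iff' ℂ _ _ _ _).1 h
  have h0 := congrFun ha 0
  have h1 := congrFun ha 1
  simp at h0 h1
  simpa [h0] using h1.symm

theorem card_le_of_eval_rep_eq_zero {φ : MvPolynomial (Fin 2) ℂ} {d : ℕ}
    (hφ : φ.IsHomogeneous d) (hφ0 : φ ≠ 0) (T : Finset (Pt 2))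
    (hT : ∀ p ∈ T, eval p.rep φ = 0) : T.card ≤ d := by
  let L : Pt 2 → MvPolynomial (Fin 2) ℂ := fun p => linForm 0 1 (p.rep 0) (p.rep 1)
  have hL : ∀ p, Irreducible (L p) := fun p => irreducible_linForm (by decide) p.rep_ne_zero
  have hdvd : ∏ p ∈ T, L p ∣ φ := by
    refine Finset.prod_dvd_of_isRelPrime (fun p _ q _ hpq => ?_) fun p hp => ?_
    · refine ((hL p).isRelPrime_iff_not_dvd).2 fun hd => hpq (Pt.eq_of_det_eq_zero ?_)
      have := map_dvd (eval p.rep) hd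
      simpa [L, linForm, mul_comm] using this
    · refine linForm_dvd (θ := fun k => C (p.rep k)) hφ rfl rfl ?_ p.rep_ne_zero rfl rfl ?_ ?_
      · intro k; fin_cases k <;> simp
      · intro k; fin_cases k <;> simp
      · have : aeval (fun k => C (p.rep k)) φ = (C (eval p.rep φ) : MvPolynomial (Fin 2) ℂ) := by
          rw [← coe_aeval_eq_eval, ← algebraMap_eq]
          exact aeval_algebraMap_apply _ _ _
        rw [this, hT p hp, C_0]
  have hprod : (∏ p ∈ T, L p).IsHomogeneous T.card := by
    simpa using IsHomogeneous.prod T L (fun _ => 1) fun p _ => isHomogeneous_linForm _ _ _ _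
  rw [← hprod.totalDegree (Finset.prod_ne_zero_iff.2 fun p _ => (hL p).ne_zero),
    ← hφ.totalDegree hφ0]
  exact totalDegree_le_of_dvd_of_isDomain hdvd hφ0

theorem finite_setOf_eval_rep_eq_zero {φ : MvPolynomial (Fin 2) ℂ} {d : ℕ}
    (hφ : φ.IsHomogeneous d) (hφ0 : φ ≠ 0) : {p : Pt 2 | eval p.rep φ = 0}.Finite := by
  by_contra h
  obtain ⟨T, hT, hc⟩ := Set.Infinite.exists_subset_card_eq h (d + 1)
  have := card_le_of_eval_rep_eq_zero hφ hφ0 T hT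
  omega

theorem eval_rep_mk_eq_zero_iff {φ : MvPolynomial (Fin 2) ℂ} {d : ℕ}
    (hφ : φ.IsHomogeneous d) {u : Fin 2 → ℂ} (hu : u ≠ 0) :
    eval (Projectivization.mk ℂ u hu).rep φ = 0 ↔ eval u φ = 0 := by
  obtain ⟨a, ha⟩ := Projectivization.exists_smul_eq_mk_rep ℂ u hu
  have := IsWeightedHomogeneous.aeval_pow_mul hφ (a : ℂ) u
  rw [← ha]
  simp only [Pi.one_apply, pow_one] at this
  have h2 : eval (a • u) φ = a ^ d * eval u φ := this
  rw [h2]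
  simp

theorem Bihom.eval_rep_mk_eq_zero_iff {h : MvPolynomial (Fin 2 ⊕ Fin 2) ℂ} (hh : Bihom h)
    {u v : Fin 2 → ℂ} (hu : u ≠ 0) (hv : v ≠ 0) :
    eval (Sum.elim (Projectivization.mk ℂ u hu).rep (Projectivization.mk ℂ v hv).rep) h = 0 ↔
      eval (Sum.elim u v) h = 0 := by
  obtain ⟨a, ha⟩ := Projectivization.exists_smul_eq_mk_rep ℂ u hu
  obtain ⟨b, hb⟩ := Projectivization.exists_smul_eq_mk_rep ℂ v hv
  obtain ⟨d, e, hd, he⟩ := hh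
  have h1 := hd.aeval_pow_mul (a : ℂ) (Sum.elim u (b • v))
  have h2 := he.aeval_pow_mul (b : ℂ) (Sum.elim u v)
  have h3 : (fun k => (a : ℂ) ^ wx 2 k * Sum.elim u (b • v) k) = Sum.elim (a • u) (b • v) := by
    ext (k | k) <;> simp [wx, Units.smul_def]
  have h4 : (fun k => (b : ℂ) ^ wy 2 k * Sum.elim u v k) = Sum.elim u (b • v) := by
    ext (k | k) <;> simp [wy, Units.smul_def]
  rw [h3] at h1
  rw [h4] at h2
  have h5 : eval (Sum.elim (a • u) (b • v)) h = a ^ d * (b ^ e * eval (Sum.elim u v) h) :=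
    h1.trans (congrArg _ h2)
  rw [← ha, ← hb, h5]
  simp

/-- The polynomial `h(u, y)` in the `y`-variables. -/
def fixX (u : Fin 2 → ℂ) (h : MvPolynomial (Fin 2 ⊕ Fin 2) ℂ) : MvPolynomial (Fin 2) ℂ :=
  aeval (Sum.elim (fun k => C (u k)) X) h

/-- The polynomial `h(x, u)` in the `x`-variables. -/
def fixY (u : Fin 2 → ℂ) (h : MvPolynomial (Fin 2 ⊕ Fin 2) ℂ) : MvPolynomial (Fin 2) ℂ :=
  aeval (Sum.elim X (fun k => C (u k))) h

theorem eval_fixX (u v : Fin 2 → ℂ) (h : MvPolynomial (Fin 2 ⊕ Fin 2) ℂ) :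
    eval v (fixX u h) = eval (Sum.elim u v) h := by
  rw [fixX, ← coe_aeval_eq_eval, ← coe_aeval_eq_eval]
  simp only [RingHom.coe_coe]
  rw [comp_aeval_apply]
  congr 2
  ext (k | k) <;> simp

theorem eval_fixY (u v : Fin 2 → ℂ) (h : MvPolynomial (Fin 2 ⊕ Fin 2) ℂ) :
    eval u (fixY v h) = eval (Sum.elim u v) h := by
  rw [fixY, ← coe_aeval_eq_eval, ← coe_aeval_eq_eval]
  simp only [RingHom.coe_coe]
  rw [comp_aeval_apply]
  congr 2
  ext (k | k) <;> simp

theorem Bihom.isHomogeneous_fixX {h : MvPolynomial (Fin 2 ⊕ Fin 2) ℂ} (hh : Bihom h) (h0 : h ≠ 0)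
    (u : Fin 2 → ℂ) : (fixX u h).IsHomogeneous (ydeg h) := by
  obtain ⟨-, e, -, he⟩ := hh
  have : ydeg h = e := by
    have := he.weighted_total_degree h0
    rw [weightedTotalDegree_coe _ _ h0] at this
    exact_mod_cast this
  rw [this]
  refine he.isHomogeneous_aeval _ ?_
  rintro (k | k)
  · exact isHomogeneous_C _ _
  · exact isHomogeneous_X _ _

theorem Bihom.fixX_ne_zero {h : MvPolynomial (Fin 2 ⊕ Fin 2) ℂ} (hh : Bihom h)
    (hirr : Irreducible h) (hy : 0 < ydeg h) {u : Fin 2 → ℂ} (hu : u 0 ≠ 0 ∨ u 1 ≠ 0) :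
    fixX u h ≠ 0 := by
  intro h0
  obtain ⟨d, -, hd, -⟩ := hh
  refine hy.ne' (weightedTotalDegree_eq_zero_of_linForm_dvd (i := Sum.inl 0) (j := Sum.inl 1)
    hirr (by simp) hu ?_ rfl rfl)
  refine linForm_dvd (θ := Sum.elim (fun k => C (u k)) (fun k => X (Sum.inr k))) hd rfl rfl
    ?_ hu rfl rfl ?_ ?_
  · rintro (k | k) <;> fin_cases k <;> simp [wx]
  · rintro (k | k) <;> fin_cases k <;> simp
  · have h1 := congrArg (rename Sum.inr : _ →ₐ[ℂ] MvPolynomial (Fin 2 ⊕ Fin 2) ℂ) h0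
    rw [fixX, comp_aeval_apply, map_zero] at h1
    rw [← h1]
    congr 2
    ext1 (k | k) <;> simp

theorem Bihom.fixY_ne_zero {h : MvPolynomial (Fin 2 ⊕ Fin 2) ℂ} (hh : Bihom h)
    (hirr : Irreducible h) (hx : 0 < xdeg h) {u : Fin 2 → ℂ} (hu : u 0 ≠ 0 ∨ u 1 ≠ 0) :
    fixY u h ≠ 0 := by
  intro h0
  obtain ⟨-, d, -, hd⟩ := hh
  refine hx.ne' (weightedTotalDegree_eq_zero_of_linForm_dvd (i := Sum.inr 0) (j := Sum.inr 1)
    hirr (by simp) hu ?_ rfl rfl)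
  refine linForm_dvd (θ := Sum.elim (fun k => X (Sum.inl k)) (fun k => C (u k))) hd rfl rfl
    ?_ hu rfl rfl ?_ ?_
  · rintro (k | k) <;> fin_cases k <;> simp [wy]
  · rintro (k | k) <;> fin_cases k <;> simp
  · have h1 := congrArg (rename Sum.inl : _ →ₐ[ℂ] MvPolynomial (Fin 2 ⊕ Fin 2) ℂ) h0
    rw [fixY, comp_aeval_apply, map_zero] at h1
    rw [← h1]
    congr 2
    ext1 (k | k) <;> simp

theorem MvPolynomial.exists_mem_support_eq_zero_of_not_X_dvd {σ : Type*} {φ : MvPolynomial σ ℂ}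
    {i : σ} (hφ : ¬ X i ∣ φ) : ∃ m ∈ φ.support, m i = 0 := by
  by_contra! hm
  refine hφ ?_
  rw [φ.as_sum]
  exact Finset.dvd_sum fun m h => X_dvd_monomial.2 (Or.inr (hm m h))

theorem Bihom.ydeg_le_degreeOf {h : MvPolynomial (Fin 2 ⊕ Fin 2) ℂ} (hh : Bihom h)
    (hirr : Irreducible h) (hx : 0 < xdeg h) : ydeg h ≤ h.degreeOf (Sum.inr 1) := by
  have hX : ¬ X (Sum.inr 0) ∣ h := fun hd =>
    hx.ne' (weightedTotalDegree_eq_zero_of_linForm_dvd (i := Sum.inr 0) (j := Sum.inr 1)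
      (a := 0) (b := 1) hirr (by simp) (by simp) (by simpa [linForm] using hd) rfl rfl)
  obtain ⟨m, hm, hm0⟩ := exists_mem_support_eq_zero_of_not_X_dvd hX
  obtain ⟨-, e, -, he⟩ := hh
  have hw : ∀ m : Fin 2 ⊕ Fin 2 →₀ ℕ, Finsupp.weight (wy 2) m = m (Sum.inr 0) + m (Sum.inr 1) := by
    intro m
    rw [Finsupp.weight_apply, Finsupp.sum_fintype _ _ (by simp)]
    simp [wy]
  have hme := he (mem_support_iff.1 hm)
  rw [hw, hm0, zero_add] at hme
  refine le_trans ?_ (monomial_le_degreeOf _ hm)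
  refine Finset.sup_le fun m' hm' => ?_
  rw [he (mem_support_iff.1 hm'), hme]

/-- Enumeration of the variables that singles out `y₁` (as `none`). -/
def splitVars : Fin 2 ⊕ Fin 2 ≃ Option (Option (Fin 2)) where
  toFun := Sum.elim (fun k => some (some k)) ![some none, none]
  invFun := fun k => k.elim (Sum.inr 1) fun k => k.elim (Sum.inr 0) Sum.inl
  left_inv := by rintro (k | k) <;> fin_cases k <;> rfl
  right_inv := by rintro (_ | _ | k) <;> rfl

/-- Polynomials in `x₀, x₁, y₀, y₁` as univariate polynomials in `y₁`. -/
def toPolyLastVar : MvPolynomial (Fin 2 ⊕ Fin 2) ℂ ≃ₐ[ℂ]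
    Polynomial (MvPolynomial (Option (Fin 2)) ℂ) :=
  (renameEquiv ℂ splitVars).trans (optionEquivLeft ℂ _)

theorem natDegree_toPolyLastVar (h : MvPolynomial (Fin 2 ⊕ Fin 2) ℂ) :
    (toPolyLastVar h).natDegree = h.degreeOf (Sum.inr 1) := by
  rw [← degreeOf_rename_of_injective splitVars.injective]
  exact natDegree_optionEquivLeft _ _

theorem eval_map_toPolyLastVar (h : MvPolynomial (Fin 2 ⊕ Fin 2) ℂ) (v : Option (Fin 2) → ℂ)
    (z : ℂ) : ((toPolyLastVar h).map (eval v)).eval z =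
      eval (Sum.elim (fun k => v (some k)) ![v none, z]) h := by
  refine (optionEquivLeft_elim_eval ℂ _ v z (rename splitVars h)).symm.trans ?_
  rw [eval_rename]
  congr 2
  ext (k | k) <;> fin_cases k <;> rfl

/-- For a generic `p`, the polynomials `h i (p, ·)` have at least `∑ i, ydeg (h i)` zeros in
total, and these can be kept away from any given finite set. -/
theorem exists_many_zeros {n : ℕ} (h : Fin n → MvPolynomial (Fin 2 ⊕ Fin 2) ℂ)
    (hirr : ∀ i, Irreducible (h i)) (hbh : ∀ i, Bihom (h i))
    (hxpos : ∀ i, 0 < xdeg (h i)) (hypos : ∀ i, 0 < ydeg (h i))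
    (hnassoc : ∀ i j, i ≠ j → ¬ Associated (h i) (h j))
    {ψ : MvPolynomial (Fin 2) ℂ} {d : ℕ} (hψ : ψ.IsHomogeneous d) (hψ0 : ψ ≠ 0)
    (B : Finset (Pt 2)) :
    ∃ (p : Pt 2) (T : Finset (Pt 2)), eval p.rep ψ ≠ 0 ∧ ∑ i, ydeg (h i) ≤ T.card ∧
      Disjoint T B ∧ ∀ q ∈ T, ∃ i, eval (Sum.elim p.rep q.rep) (h i) = 0 := by
  classical
  have hdeg : ∀ i, ydeg (h i) ≤ (toPolyLastVar (h i)).natDegree := fun i =>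
    (natDegree_toPolyLastVar (h i)).symm ▸ (hbh i).ydeg_le_degreeOf (hirr i) (hxpos i)
  obtain ⟨c, hc0, hc⟩ := exists_ne_zero_sum_natDegree_le_card_roots
    (fun i => toPolyLastVar (h i))
    (fun i => (MulEquiv.irreducible_iff toPolyLastVar).2 (hirr i))
    (fun i => ((hypos i).trans_le (hdeg i)).ne')
    (fun i j hij ha => hnassoc i j hij (by
      simpa using ha.map (toPolyLastVar.symm : _ →* MvPolynomial (Fin 2 ⊕ Fin 2) ℂ)))
  have hinj : Function.Injective (rename some : MvPolynomial (Fin 2) ℂ →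
      MvPolynomial (Option (Fin 2)) ℂ) := rename_injective _ (Option.some_injective _)
  let G : MvPolynomial (Option (Fin 2)) ℂ := c * X none * X (some 0) * rename some ψ *
    ∏ q ∈ B, ∏ i, rename some (fixY q.rep (h i))
  have hG : G ≠ 0 := by
    refine mul_ne_zero (mul_ne_zero (mul_ne_zero (mul_ne_zero hc0 (X_ne_zero _)) (X_ne_zero _))
      ((map_ne_zero_iff _ hinj).2 hψ0)) ?_
    exact Finset.prod_ne_zero_iff.2 fun q _ => Finset.prod_ne_zero_iff.2 fun i _ =>
      (map_ne_zero_iff _ hinj).2 ((hbh i).fixY_ne_zero (hirr i) (hxpos i) q.rep_ne_zero)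
  obtain ⟨v, hv⟩ : ∃ v, eval v G ≠ 0 := by
    by_contra! hv
    exact hG (MvPolynomial.funext fun v => by rw [hv v, map_zero])
  simp only [G, map_mul, map_prod, mul_ne_zero_iff, Finset.prod_ne_zero_iff, eval_X,
    eval_rename] at hv
  obtain ⟨⟨⟨⟨hvc, hvn⟩, hv0⟩, hvψ⟩, hvB⟩ := hv
  obtain ⟨hcard, hP0⟩ := hc (eval v) hvc
  set P := (∏ i, toPolyLastVar (h i)).map (eval v)
  have hu : (fun k => v (some k)) ≠ 0 := fun h => hv0 (congrFun h 0)
  have hy : ∀ z : ℂ, ![v none, z] ≠ 0 := fun z h => hvn (congrFun h 0)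
  let Q : ℂ → Pt 2 := fun z => Projectivization.mk ℂ ![v none, z] (hy z)
  have hQ : Function.Injective Q := by
    intro z z' hz
    obtain ⟨a, ha⟩ := (Projectivization.mk_eq_mk_iff' ℂ _ _ _ _).1 hz
    have h0 := congrFun ha 0
    have h1 := congrFun ha 1
    simp [hvn] at h0 h1
    simpa [h0] using h1.symm
  have hroot : ∀ z ∈ P.roots.toFinset, ∃ i,
      eval (Sum.elim (fun k => v (some k)) ![v none, z]) (h i) = 0 := by
    intro z hz
    rw [Multiset.mem_toFinset, Polynomial.mem_roots hP0, Polynomial.IsRoot.def,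
      show P = _ from Polynomial.map_prod _ _ _,
      Polynomial.eval_prod, Finset.prod_eq_zero_iff] at hz
    obtain ⟨i, -, hi⟩ := hz
    exact ⟨i, by rwa [eval_map_toPolyLastVar] at hi⟩
  have hzero : ∀ q ∈ P.roots.toFinset.image Q, ∃ i,
      eval (Sum.elim (Projectivization.mk ℂ _ hu).rep q.rep) (h i) = 0 := by
    intro q hq
    obtain ⟨z, hz, rfl⟩ := Finset.mem_image.1 hq
    obtain ⟨i, hi⟩ := hroot z hz
    exact ⟨i, ((hbh i).eval_rep_mk_eq_zero_iff hu (hy z)).2 hi⟩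
  refine ⟨Projectivization.mk ℂ _ hu, P.roots.toFinset.image Q,
    fun h0 => hvψ ((eval_rep_mk_eq_zero_iff hψ hu).1 h0), ?_, ?_, hzero⟩
  · rw [Finset.card_image_of_injective _ hQ]
    exact (Finset.sum_le_sum fun i _ => hdeg i).trans hcard
  · refine Finset.disjoint_left.2 fun q hq hqB => ?_
    obtain ⟨i, hi⟩ := hzero q hq
    refine hvB q hqB i (Finset.mem_univ i) ?_
    have := (hbh i).eval_rep_mk_eq_zero_iff hu q.rep_nonzero
    rw [q.mk_rep] at this
    exact (eval_fixY _ _ _).trans (this.1 hi)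

theorem ZarOpen.exists_subset {X : Set (Pt 2)} (hX : ZarOpen X) (hne : X.Nonempty) :
    ∃ (ψ : MvPolynomial (Fin 2) ℂ) (d : ℕ), ψ.IsHomogeneous d ∧ ψ ≠ 0 ∧
      ∀ p : Pt 2, eval p.rep ψ ≠ 0 → p ∈ X := by
  obtain ⟨S, hS, rfl⟩ := hX
  obtain ⟨p, hp⟩ := hne
  simp only [Set.mem_ofPred_eq, not_forall] at hp
  obtain ⟨ψ, hψS, hψ⟩ := hp
  obtain ⟨d, hd⟩ := hS ψ hψS
  exact ⟨ψ, d, hd, fun h => hψ (by rw [h, map_zero]), fun q hq hall => hq (hall ψ hψS)⟩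

/-- Theorem 3.1 of the paper. Let `F` be a nonzero bihomogeneous polynomial
in `x₀,x₁,y₀,y₁` with factorization `F = f(x)·g(y)·h₁^{r₁}⋯h_n^{r_n}` into an `x`-part, a
`y`-part, and pairwise non-associate irreducible bihomogeneous factors depending on both
groups of variables.  For nonempty Zariski-open `X, Y ⊆ ℙ¹` and `t ≥ 1`, the set
`{F = 0} ∩ (X × Y)` is `(1,t)`-grid-free iff `{f = 0} ∩ X = ∅` and
`|{g = 0} ∩ Y| + d₁ + ⋯ + d_n < t`, where `dᵢ = deg_y hᵢ`. -/
theorem stmt0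
    (F : MvPolynomial (Fin 2 ⊕ Fin 2) ℂ) (hF0 : F ≠ 0) (hFbh : Bihom F)
    (X Y : Set (Pt 2)) (hX : ZarOpen X) (hY : ZarOpen Y)
    (hXne : X.Nonempty) (hYne : Y.Nonempty)
    (t : ℕ) (ht : 1 ≤ t)
    (f g : MvPolynomial (Fin 2) ℂ)
    (hf : ∃ d, f.IsHomogeneous d) (hg : ∃ d, g.IsHomogeneous d)
    (n : ℕ) (h : Fin n → MvPolynomial (Fin 2 ⊕ Fin 2) ℂ) (r : Fin n → ℕ)
    (hirr : ∀ i, Irreducible (h i))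
    (hbh : ∀ i, Bihom (h i))
    (hxpos : ∀ i, 0 < xdeg (h i)) (hypos : ∀ i, 0 < ydeg (h i))
    (hnassoc : ∀ i j, i ≠ j → ¬ Associated (h i) (h j))
    (hr : ∀ i, 1 ≤ r i)
    (hfact : F = rename Sum.inl f * rename Sum.inr g * ∏ i, h i ^ r i) :
    GridFree 1 t (zeroSet F ∩ X ×ˢ Y) ↔
      ({p ∈ X | eval p.rep f = 0} = ∅ ∧
        {q ∈ Y | eval q.rep g = 0}.ncard + ∑ i, ydeg (h i) < t) := by
  classical
  obtain ⟨df, hfd⟩ := hf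
  obtain ⟨dg, hgd⟩ := hg
  have hg0 : g ≠ 0 := by
    rintro rfl
    exact hF0 (by rw [hfact, map_zero, mul_zero, zero_mul])
  have hf0 : f ≠ 0 := by
    rintro rfl
    exact hF0 (by rw [hfact, map_zero, zero_mul, zero_mul])
  have heval : ∀ u v : Fin 2 → ℂ, eval (Sum.elim u v) F = 0 ↔
      eval u f = 0 ∨ eval v g = 0 ∨ ∃ i, eval (Sum.elim u v) (h i) = 0 := by
    intro u v
    have hr' : ∀ i, r i ≠ 0 := fun i => Nat.one_le_iff_ne_zero.1 (hr i)
    simp [hfact, eval_rename, Function.comp_def, Finset.prod_eq_zero_iff, hr', or_assoc]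
  have hgfin := finite_setOf_eval_rep_eq_zero hgd hg0
  have hGfin : {q ∈ Y | eval q.rep g = 0}.Finite := hgfin.subset fun q hq => hq.2
  obtain ⟨ψX, dX, hψX, hψX0, hXsub⟩ := hX.exists_subset hXne
  obtain ⟨ψY, dY, hψY, hψY0, hYsub⟩ := hY.exists_subset hYne
  have hYfin := finite_setOf_eval_rep_eq_zero hψY hψY0
  constructor
  · intro hfree
    constructor
    · rw [Set.eq_empty_iff_forall_notMem]
      rintro p ⟨hpX, hpf⟩
      have hYinf : Y.Infinite := hYfin.infinite_compl.mono fun q hq => hYsub q hq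
      obtain ⟨T, hTY, hT⟩ := hYinf.exists_subset_card_eq t
      refine hfree ⟨{p}, T, Finset.card_singleton p, hT, fun a ha b hb => ?_⟩
      rw [Finset.mem_singleton.1 ha]
      exact ⟨(heval _ _).2 (Or.inl hpf), hpX, hTY hb⟩
    · by_contra! hle
      obtain ⟨p, T, hp, hcard, hdisj, hT⟩ := exists_many_zeros h hirr hbh hxpos hypos hnassoc
        hψX hψX0 (hYfin.toFinset ∪ hgfin.toFinset)
      rw [Finset.disjoint_union_right] at hdisj
      have hdisj' : Disjoint hGfin.toFinset T :=
        hdisj.2.symm.mono_left fun q hq => by simpa using (hGfin.mem_toFinset.1 hq).2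
      rw [Set.ncard_eq_toFinset_card _ hGfin] at hle
      obtain ⟨T', hT', hT'c⟩ := Finset.exists_subset_card_eq
        (s := hGfin.toFinset ∪ T) (n := t) (by rw [Finset.card_union_of_disjoint hdisj']; omega)
      refine hfree ⟨{p}, T', Finset.card_singleton p, hT'c, fun a ha b hb => ?_⟩
      rw [Finset.mem_singleton.1 ha]
      rcases Finset.mem_union.1 (hT' hb) with hbG | hbT
      · have hb' := hGfin.mem_toFinset.1 hbG
        exact ⟨(heval _ _).2 (Or.inr (Or.inl hb'.2)), hXsub p hp, hb'.1⟩
      · refine ⟨(heval _ _).2 (Or.inr (Or.inr (hT b hbT))), hXsub p hp, hYsub b fun h0 => ?_⟩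
        exact Finset.disjoint_left.1 hdisj.1 hbT (hYfin.mem_toFinset.2 h0)
  · rintro ⟨hfX, hlt⟩ ⟨S, T, hS, rfl, hST⟩
    obtain ⟨p, rfl⟩ := Finset.card_eq_one.1 hS
    replace hST := fun q hq => hST p (Finset.mem_singleton_self p) q hq
    have hsub : T ⊆ hGfin.toFinset ∪ Finset.univ.biUnion fun i =>
        T.filter fun q => eval (Sum.elim p.rep q.rep) (h i) = 0 := by
      intro q hq
      obtain ⟨hF, hpX, hqY⟩ := hST q hq
      rcases (heval _ _).1 hF with h1 | h1 | ⟨i, hi⟩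
      · exact absurd (show p ∈ {p ∈ X | eval p.rep f = 0} from ⟨hpX, h1⟩) (by simp [hfX])
      · exact Finset.mem_union_left _ (hGfin.mem_toFinset.2 ⟨hqY, h1⟩)
      · exact Finset.mem_union_right _ (Finset.mem_biUnion.2
          ⟨i, Finset.mem_univ i, Finset.mem_filter.2 ⟨hq, hi⟩⟩)
    have hcard := (Finset.card_le_card hsub).trans (Finset.card_union_le _ _)
    have hbound : ∀ i,
        (T.filter fun q => eval (Sum.elim p.rep q.rep) (h i) = 0).card ≤ ydeg (h i) := fun i =>
      card_le_of_eval_rep_eq_zero ((hbh i).isHomogeneous_fixX (hirr i).ne_zero p.rep)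
        ((hbh i).fixX_ne_zero (hirr i) (hypos i) p.rep_ne_zero) _ fun q hq =>
        (eval_fixX _ _ _).trans (Finset.mem_filter.1 hq).2
    have hsum := Finset.card_biUnion_le.trans (Finset.sum_le_sum fun i (_ : i ∈ Finset.univ) =>
      hbound i)
    rw [Set.ncard_eq_toFinset_card _ hGfin] at hlt
    omega
end
end

section
/- Let F ∈ ℂ[x₀,x₁,y₀,y₁] be a nonzero bihomogeneous polynomial and let Y be a nonempty Zariski-open subset of ℙ¹. Write F = f(x₀,x₁)·g(y₀,y₁)·h₁^{r₁}·…·h_n^{r_n}, where f and g are homogeneous, h₁, …, h_n are pairwise non-associate irreducible bihomogeneous polynomials each of positive degree in the x-variables and of positive degree in the y-variables, and r₁, …, r_n ≥ 1; let dᵢ denote the degree of hᵢ in the y-variables, and set M := |{g = 0} ∩ Y| + d₁ + d₂ + … + d_n. Then for all but finitely many points u ∈ ℙ¹, the set {v ∈ Y : F(u,v) = 0} has exactly M elements. -/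
open MvPolynomial

noncomputable section

/-- Over a GCD domain `R`, an irreducible nonconstant polynomial and a polynomial it does not
divide generate an ideal containing a nonzero constant. -/
theorem exists_bezout_const {R : Type*} [CommRing R] [IsDomain R] [IsGCDMonoid R]
    {p q : Polynomial R} (hp : Irreducible p) (hdeg : p.natDegree ≠ 0) (hpq : ¬ p ∣ q) :
    ∃ a b : Polynomial R, ∃ c : R, c ≠ 0 ∧ a * p + b * q = Polynomial.C c := by
  let K := FractionRing R
  have hprim := hp.isPrimitive hdeg
  have hirr := (hprim.irreducible_iff_irreducible_map_fraction_map (K := K)).1 hp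
  have hndvd : ¬ p.map (algebraMap R K) ∣ q.map (algebraMap R K) := fun h =>
    hpq (hprim.dvd_of_fraction_map_dvd_fraction_map h)
  obtain ⟨a, b, hab⟩ := (hirr.coprime_iff_not_dvd.2 hndvd)
  obtain ⟨c, hc, hc'⟩ := IsLocalization.integerNormalization_spec (nonZeroDivisors R) a
  obtain ⟨d, hd, hd'⟩ := IsLocalization.integerNormalization_spec (nonZeroDivisors R) b
  refine ⟨Polynomial.C d * IsLocalization.integerNormalization (nonZeroDivisors R) a,
    Polynomial.C c * IsLocalization.integerNormalization (nonZeroDivisors R) b, c * d,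
    mul_ne_zero (nonZeroDivisors.ne_zero hc) (nonZeroDivisors.ne_zero hd), ?_⟩
  apply Polynomial.map_injective (algebraMap R K) (IsFractionRing.injective R K)
  simp only [Polynomial.map_add, Polynomial.map_mul, Polynomial.map_C, hc', hd',
    Algebra.smul_def, Polynomial.algebraMap_apply, map_mul]
  linear_combination (Polynomial.C (algebraMap R K c) * Polynomial.C (algebraMap R K d)) * hab

theorem MvPolynomial.IsWeightedHomogeneous.aeval_pow_mul_s1 {σ R A : Type*} [CommSemiring R]
    [CommSemiring A] [Algebra R A] {w : σ → ℕ} {F : MvPolynomial σ R} {n : ℕ}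
    (hF : F.IsWeightedHomogeneous w n) (c : A) (z : σ → A) :
    aeval (fun i => c ^ w i * z i) F = c ^ n * aeval z F := by
  simp only [aeval_def, eval₂_eq, Finset.mul_sum]
  refine Finset.sum_congr rfl fun d hd => ?_
  have h := hF (mem_support_iff.1 hd)
  rw [Finsupp.weight_apply, Finsupp.sum] at h
  simp only [mul_pow, Finset.prod_mul_distrib, ← pow_mul, Finset.prod_pow_eq_pow_sum]
  rw [← h]
  simp only [smul_eq_mul, mul_comm (w _)]
  ring

theorem aeval_smul_left {A : Type*} [CommSemiring A] [Algebra ℂ A] {n a : ℕ}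
    {F : MvPolynomial (Fin n ⊕ Fin n) ℂ} (hF : F.IsWeightedHomogeneous (wx n) a)
    (c : A) (x y : Fin n → A) :
    aeval (Sum.elim (c • x) y) F = c ^ a * aeval (Sum.elim x y) F := by
  rw [← hF.aeval_pow_mul_s1]
  congr 2
  ext (i | i) <;> simp [wx]

theorem aeval_smul_right {A : Type*} [CommSemiring A] [Algebra ℂ A] {n b : ℕ}
    {F : MvPolynomial (Fin n ⊕ Fin n) ℂ} (hF : F.IsWeightedHomogeneous (wy n) b)
    (c : A) (x y : Fin n → A) :
    aeval (Sum.elim x (c • y)) F = c ^ b * aeval (Sum.elim x y) F := by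
  rw [← hF.aeval_pow_mul_s1]
  congr 2
  ext (i | i) <;> simp [wy]

/-- Vanishing of a bihomogeneous polynomial does not depend on the representative vectors. -/
theorem Bihom.eval_smul_eq_zero_iff {n : ℕ} {F : MvPolynomial (Fin n ⊕ Fin n) ℂ} (hF : Bihom F)
    {c d : ℂ} (hc : c ≠ 0) (hd : d ≠ 0) (x y : Fin n → ℂ) :
    eval (Sum.elim (c • x) (d • y)) F = 0 ↔ eval (Sum.elim x y) F = 0 := by
  obtain ⟨a, b, ha, hb⟩ := hF
  simp only [← coe_aeval_eq_eval, RingHom.coe_coe, aeval_smul_left ha, aeval_smul_right hb]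
  simp [hc, hd]

theorem MvPolynomial.IsHomogeneous.eval_smul_eq_zero_iff {σ : Type*} {F : MvPolynomial σ ℂ}
    {d : ℕ} (hF : F.IsHomogeneous d) {c : ℂ} (hc : c ≠ 0) (x : σ → ℂ) :
    eval (c • x) F = 0 ↔ eval x F = 0 := by
  have := IsWeightedHomogeneous.aeval_pow_mul_s1 hF c x
  simp only [← coe_aeval_eq_eval, RingHom.coe_coe]
  rw [show c • x = fun i => c ^ (1 : σ → ℕ) i * x i by ext; simp, this]
  simp [hc]

theorem Pt.exists_smul_rep_eq_or {η : ℂ} (hη : η ≠ 0) (u : Pt 2) :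
    (∃ c t : ℂ, c ≠ 0 ∧ c • u.rep = ![t, η]) ∨ ∃ c : ℂ, c ≠ 0 ∧ c • u.rep = ![1, 0] := by
  have hu := u.rep_nonzero
  by_cases h1 : u.rep 1 = 0
  · have h0 : u.rep 0 ≠ 0 := fun h0 => hu (by ext i; fin_cases i <;> simpa)
    refine Or.inr ⟨(u.rep 0)⁻¹, inv_ne_zero h0, ?_⟩
    ext i; fin_cases i <;> simp [h0, h1]
  · refine Or.inl ⟨η / u.rep 1, η / u.rep 1 * u.rep 0, div_ne_zero hη h1, ?_⟩
    ext i; fin_cases i <;> simp [h1]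

theorem Pt.eq_mk_of_smul_rep {n : ℕ} {u : Pt n} {c : ℂ} {x : Fin n → ℂ} (hx : x ≠ 0)
    (h : c • u.rep = x) : u = Projectivization.mk ℂ x hx := by
  rw [← u.mk_rep, eq_comm, Projectivization.mk_eq_mk_iff']
  exact ⟨c, h⟩

theorem affine_ne_zero {η : ℂ} (hη : η ≠ 0) (t : ℂ) : ![t, η] ≠ 0 := fun h =>
  hη (by simpa using congrFun h 1)

/-- A nonzero polynomial vanishes identically on at most finitely many points of `ℙ¹`, viewed as
lines in the plane. -/
theorem eventually_exists_eval_smul_ne_zero {q : MvPolynomial (Fin 2) ℂ} (hq : q ≠ 0) :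
    ∀ᶠ u : Pt 2 in Filter.cofinite, ∃ c : ℂ, c ≠ 0 ∧ eval (c • u.rep) q ≠ 0 := by
  obtain ⟨z, hz⟩ : ∃ z, eval z (q * X 1) ≠ 0 := by
    by_contra! h
    exact mul_ne_zero hq (X_ne_zero 1) (MvPolynomial.funext fun z => by simp [h z])
  simp only [map_mul, eval_X, ne_eq, mul_eq_zero, not_or] at hz
  obtain ⟨hqz, hη⟩ := hz
  let p : Polynomial ℂ := aeval ![Polynomial.X, Polynomial.C (z 1)] q
  have hp : ∀ t, p.eval t = eval ![t, z 1] q := fun t => by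
    change ((Polynomial.aeval t).comp (aeval ![Polynomial.X, Polynomial.C (z 1)])) q = aeval _ q
    congr 1
    ext i; fin_cases i <;> simp
  have hp0 : p ≠ 0 := fun h => hqz <| by
    rw [← (by ext i; fin_cases i <;> simp : ![z 0, z 1] = z), ← hp, h, Polynomial.eval_zero]
  have hfin : (insert (Projectivization.mk ℂ ![1, 0] (by simp))
      ((fun t => Projectivization.mk ℂ _ (affine_ne_zero hη t)) '' {t | p.IsRoot t})).Finite :=
    ((Polynomial.finite_setOfPred_isRoot hp0).image _).insert _
  filter_upwards [hfin.compl_mem_cofinite] with u hu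
  rcases Pt.exists_smul_rep_eq_or hη u with ⟨c, t, hc, h⟩ | ⟨c, hc, h⟩
  · refine ⟨c, hc, fun h0 => hu (Or.inr ⟨t, ?_, (Pt.eq_mk_of_smul_rep _ h).symm⟩)⟩
    rwa [Set.mem_ofPred, Polynomial.IsRoot, hp, ← h]
  · exact absurd (Or.inl (Pt.eq_mk_of_smul_rep _ h)) hu

theorem ZarOpen.eventually_mem {Y : Set (Pt 2)} (hY : ZarOpen Y) (hne : Y.Nonempty) :
    ∀ᶠ v in Filter.cofinite, v ∈ Y := by
  obtain ⟨S, hS, rfl⟩ := hY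
  obtain ⟨p, hp⟩ := hne
  simp only [Set.mem_ofPred_eq, not_forall] at hp ⊢
  obtain ⟨g, hg, hgp⟩ := hp
  obtain ⟨d, hd⟩ := hS g hg
  filter_upwards [eventually_exists_eval_smul_ne_zero (q := g) (by rintro rfl; simp at hgp)]
    with u ⟨c, hc, hu⟩
  exact ⟨g, hg, by rwa [← hd.eval_smul_eq_zero_iff hc]⟩

theorem MvPolynomial.IsWeightedHomogeneous.weightedTotalDegree_eq {σ R : Type*} [CommSemiring R]
    {w : σ → ℕ} {F : MvPolynomial σ R} {n : ℕ} (hF : F.IsWeightedHomogeneous w n) (h0 : F ≠ 0) :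
    weightedTotalDegree w F = n := by
  have := hF.weighted_total_degree h0
  rwa [weightedTotalDegree_coe _ _ h0, WithBot.coe_inj] at this

/-- The restriction of an irreducible bihomogeneous polynomial of positive degree in the
`x`-variables to `ℙ¹ × {w}` is not identically zero. -/
theorem Bihom.slice_ne_zero {F : MvPolynomial (Fin 2 ⊕ Fin 2) ℂ} (hF : Bihom F)
    (hirr : Irreducible F) (hx : 0 < xdeg F) {w : Fin 2 → ℂ} (hw : w ≠ 0) :
    aeval (Sum.elim X (fun i => C (w i))) F ≠ (0 : MvPolynomial (Fin 2) ℂ) := by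
  intro hzero
  obtain ⟨a, b, ha, hb⟩ := hF
  let L : MvPolynomial (Fin 2 ⊕ Fin 2) ℂ := C (w 1) * X (Sum.inr 0) - C (w 0) * X (Sum.inr 1)
  let A := MvPolynomial (Fin 2 ⊕ Fin 2) ℂ ⧸ Ideal.span {L}
  let π : MvPolynomial (Fin 2 ⊕ Fin 2) ℂ →ₐ[ℂ] A := Ideal.Quotient.mkₐ ℂ _
  let x : Fin 2 → A := fun i => π (X (Sum.inl i))
  let y : Fin 2 → A := fun i => π (X (Sum.inr i))
  have hπ : ∀ P, π P = aeval (Sum.elim x y) P := fun P => by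
    conv_lhs => rw [aeval_unique π]
    congr 2
    ext (i | i) <;> rfl
  have hL : algebraMap ℂ A (w 1) * y 0 = algebraMap ℂ A (w 0) * y 1 := by
    have : π L = 0 := Ideal.Quotient.eq_zero_iff_mem.2 (Ideal.mem_span_singleton_self L)
    rw [hπ] at this
    simpa [L, sub_eq_zero] using this
  have hy : ∀ i j, algebraMap ℂ A (w j) * y i = y j * algebraMap ℂ A (w i) := by
    intro i j
    fin_cases i <;> fin_cases j
    · exact mul_comm _ _
    · exact hL.trans (mul_comm _ _)
    · exact hL.symm.trans (mul_comm _ _)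
    · exact mul_comm _ _
  obtain ⟨j, hj⟩ := Function.ne_iff.1 hw
  have hslice : aeval (Sum.elim x (fun i => algebraMap ℂ A (w i))) F = 0 := by
    have h := congrArg (aeval x : MvPolynomial (Fin 2) ℂ →ₐ[ℂ] A) hzero
    rw [map_zero, ← AlgHom.comp_apply, comp_aeval] at h
    rw [← h]
    congr 2
    ext (i | i) <;> simp
  have hmul : algebraMap ℂ A (w j) ^ b * π F = 0 := by
    rw [hπ, ← aeval_smul_right hb,
      show algebraMap ℂ A (w j) • y = y j • fun i => algebraMap ℂ A (w i) from
        funext fun i => hy i j, aeval_smul_right hb, hslice, mul_zero]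
  have hFπ : π F = 0 := by
    have hu : IsUnit (algebraMap ℂ A (w j) ^ b) := ((IsUnit.mk0 _ hj).map _).pow b
    exact hu.mul_right_eq_zero.1 hmul
  obtain ⟨k, hk⟩ := Ideal.mem_span_singleton.1 (Ideal.Quotient.eq_zero_iff_mem.1 hFπ)
  rcases hirr.isUnit_or_isUnit hk with hu | hu
  · simpa [L] using hu.map (eval (0 : Fin 2 ⊕ Fin 2 → ℂ))
  · obtain ⟨r, -, rfl⟩ := isUnit_iff_eq_C_of_isReduced.1 hu
    have hC := isWeightedHomogeneous_C (R := ℂ) (wx 2)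
    have hX : ∀ i, IsWeightedHomogeneous (wx 2) (X (Sum.inr i) : MvPolynomial _ ℂ) 0 :=
      fun i => isWeightedHomogeneous_X ℂ (wx 2) (Sum.inr i)
    have hL0 : IsWeightedHomogeneous (wx 2) L 0 :=
      Submodule.sub_mem (weightedHomogeneousSubmodule ℂ (wx 2) 0)
        ((hC (w 1)).mul (hX 0)) ((hC (w 0)).mul (hX 1))
    have hF0 : IsWeightedHomogeneous (wx 2) F 0 := by
      rw [hk]
      exact hL0.mul (hC r)
    exact hx.ne' (hF0.weightedTotalDegree_eq hirr.ne_zero)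

theorem eval_aeval_slice (F : MvPolynomial (Fin 2 ⊕ Fin 2) ℂ) (x w : Fin 2 → ℂ) :
    eval x (aeval (Sum.elim X (fun i => C (w i))) F : MvPolynomial (Fin 2) ℂ) =
      eval (Sum.elim x w) F := by
  change ((aeval x).comp (aeval _)) F = aeval (Sum.elim x w) F
  rw [comp_aeval]
  congr 2
  ext (i | i) <;> simp

theorem Bihom.eventually_eval_ne_zero {F : MvPolynomial (Fin 2 ⊕ Fin 2) ℂ} (hF : Bihom F)
    (hirr : Irreducible F) (hx : 0 < xdeg F) {w : Fin 2 → ℂ} (hw : w ≠ 0) :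
    ∀ᶠ u : Pt 2 in Filter.cofinite, eval (Sum.elim u.rep w) F ≠ 0 := by
  filter_upwards [eventually_exists_eval_smul_ne_zero (hF.slice_ne_zero hirr hx hw)]
    with u ⟨c, hc, hu⟩
  rwa [eval_aeval_slice, ← one_smul ℂ w, ne_eq,
    hF.eval_smul_eq_zero_iff hc one_ne_zero] at hu

/-- The one-variable polynomial `F(x, (t, η))` in `t`. -/
def fiberPoly (η : ℂ) (x : Fin 2 → ℂ) (F : MvPolynomial (Fin 2 ⊕ Fin 2) ℂ) : Polynomial ℂ :=
  aeval (Sum.elim (fun i => Polynomial.C (x i)) ![Polynomial.X, Polynomial.C η]) F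

/-- View a polynomial in `x₀, x₁, y₀, y₁` as a polynomial in `y₀` over `ℂ[y₁, x₀, x₁]`. -/
def polyEquiv :
    MvPolynomial (Fin 2 ⊕ Fin 2) ℂ ≃ₐ[ℂ] Polynomial (MvPolynomial (Fin 3) ℂ) :=
  (renameEquiv ℂ ((Equiv.sumComm (Fin 2) (Fin 2)).trans finSumFinEquiv)).trans (finSuccEquiv ℂ 3)

theorem map_polyEquiv (η : ℂ) (x : Fin 2 → ℂ) (F : MvPolynomial (Fin 2 ⊕ Fin 2) ℂ) :
    (polyEquiv F).map (eval ![η, x 0, x 1]) = fiberPoly η x F := by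
  change ((Polynomial.mapAlgHom (aeval ![η, x 0, x 1])).comp polyEquiv.toAlgHom) F = aeval _ F
  congr 1
  ext1 i
  rcases i with i | i <;> fin_cases i
  · change Polynomial.map _ (finSuccEquiv ℂ 3 (rename _ (X _))) = _
    rw [rename_X]
    change Polynomial.map _ (finSuccEquiv ℂ 3 (X (Fin.succ 1))) = _
    rw [finSuccEquiv_X_succ]; simp
  · change Polynomial.map _ (finSuccEquiv ℂ 3 (rename _ (X _))) = _
    rw [rename_X]
    change Polynomial.map _ (finSuccEquiv ℂ 3 (X (Fin.succ 2))) = _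
    rw [finSuccEquiv_X_succ]; simp
  · change Polynomial.map _ (finSuccEquiv ℂ 3 (rename _ (X _))) = _
    rw [rename_X]
    change Polynomial.map _ (finSuccEquiv ℂ 3 (X 0)) = _
    rw [finSuccEquiv_X_zero]; simp
  · change Polynomial.map _ (finSuccEquiv ℂ 3 (rename _ (X _))) = _
    rw [rename_X]
    change Polynomial.map _ (finSuccEquiv ℂ 3 (X (Fin.succ 0))) = _
    rw [finSuccEquiv_X_succ]; simp

theorem eval_fiberPoly (η : ℂ) (x : Fin 2 → ℂ) (F : MvPolynomial (Fin 2 ⊕ Fin 2) ℂ) (t : ℂ) :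
    (fiberPoly η x F).eval t = eval (Sum.elim x ![t, η]) F := by
  change ((Polynomial.aeval t).comp (aeval _)) F = aeval _ F
  rw [comp_aeval]
  congr 2
  ext (i | i)
  · simp
  · fin_cases i <;> simp

theorem fiberPoly_eq_sum (η : ℂ) (x : Fin 2 → ℂ) (F : MvPolynomial (Fin 2 ⊕ Fin 2) ℂ) :
    fiberPoly η x F = ∑ d ∈ F.support, Polynomial.monomial (d (Sum.inr 0))
      (F.coeff d * (∏ i, x i ^ d (Sum.inl i)) * η ^ d (Sum.inr 1)) := by
  rw [fiberPoly, aeval_def, eval₂_eq']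
  refine Finset.sum_congr rfl fun d _ => ?_
  simp only [Fintype.prod_sum_type, Fin.prod_univ_two, ← Polynomial.C_mul_X_pow_eq_monomial]
  simp
  ring

theorem weight_wy (d : Fin 2 ⊕ Fin 2 →₀ ℕ) :
    Finsupp.weight (wy 2) d = d (Sum.inr 0) + d (Sum.inr 1) := by
  rw [Finsupp.weight_apply, Finsupp.sum_fintype _ _ (by simp)]
  simp [wy]

theorem natDegree_fiberPoly_le {F : MvPolynomial (Fin 2 ⊕ Fin 2) ℂ} {b : ℕ}
    (hF : F.IsWeightedHomogeneous (wy 2) b) (η : ℂ) (x : Fin 2 → ℂ) :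
    (fiberPoly η x F).natDegree ≤ b := by
  rw [fiberPoly_eq_sum]
  refine Polynomial.natDegree_sum_le_of_forall_le _ _ fun d hd => ?_
  refine (Polynomial.natDegree_monomial_le _).trans ?_
  have := hF (mem_support_iff.1 hd)
  rw [weight_wy] at this
  omega

theorem coeff_fiberPoly {F : MvPolynomial (Fin 2 ⊕ Fin 2) ℂ} {b : ℕ}
    (hF : F.IsWeightedHomogeneous (wy 2) b) (η : ℂ) (x : Fin 2 → ℂ) :
    (fiberPoly η x F).coeff b = eval (Sum.elim x ![1, 0]) F := by
  rw [fiberPoly_eq_sum, Polynomial.finsetSum_coeff, eval_eq']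
  refine Finset.sum_congr rfl fun d hd => ?_
  have := hF (mem_support_iff.1 hd)
  rw [weight_wy] at this
  rw [Polynomial.coeff_monomial, Fintype.prod_sum_type]
  by_cases h : d (Sum.inr 1) = 0
  · rw [if_pos (by omega)]
    simp [h]
  · rw [if_neg (by omega)]
    simp [h]

theorem natDegree_polyEquiv_ne_zero {F : MvPolynomial (Fin 2 ⊕ Fin 2) ℂ} (hF : Bihom F)
    (hirr : Irreducible F) (hx : 0 < xdeg F) (hy : 0 < ydeg F) :
    (polyEquiv F).natDegree ≠ 0 := by
  intro h0
  obtain ⟨z, hz⟩ : ∃ z, eval (Sum.elim z ![1, 0]) F ≠ 0 := by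
    by_contra! h
    exact hF.slice_ne_zero hirr hx (w := ![1, 0]) (by simp)
      (MvPolynomial.funext fun z => by rw [eval_aeval_slice, h, map_zero])
  obtain ⟨a, b, ha, hb⟩ := hF
  have hyb : ydeg F = b := hb.weightedTotalDegree_eq hirr.ne_zero
  rw [← coeff_fiberPoly hb 1, ← map_polyEquiv, Polynomial.coeff_map,
    Polynomial.coeff_eq_zero_of_natDegree_lt (by omega), map_zero] at hz
  exact hz rfl

/-- Coprimality over `ℂ(x₀, x₁, y₁)` specializes to coprimality on almost all fibres. -/
theorem exists_eventually_isCoprime {F : MvPolynomial (Fin 2 ⊕ Fin 2) ℂ} (hF : Bihom F)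
    (hirr : Irreducible F) (hx : 0 < xdeg F) (hy : 0 < ydeg F)
    {q : Polynomial (MvPolynomial (Fin 3) ℂ)} (hq : ¬ polyEquiv F ∣ q) :
    ∃ η : ℂ, η ≠ 0 ∧ ∀ᶠ u : Pt 2 in Filter.cofinite, ∃ c : ℂ, c ≠ 0 ∧
      IsCoprime (fiberPoly η (c • u.rep) F)
        (q.map (eval ![η, (c • u.rep) 0, (c • u.rep) 1])) := by
  obtain ⟨a, b, c, hc, habc⟩ := exists_bezout_const
    ((MulEquiv.irreducible_iff polyEquiv).2 hirr) (natDegree_polyEquiv_ne_zero hF hirr hx hy) hq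
  obtain ⟨z, hz⟩ : ∃ z, eval z (c * X 0) ≠ 0 := by
    by_contra! h
    exact mul_ne_zero hc (X_ne_zero 0) (MvPolynomial.funext fun z => by rw [h z, map_zero])
  simp only [map_mul, eval_X, ne_eq, mul_eq_zero, not_or] at hz
  obtain ⟨hcz, hη⟩ := hz
  let c' : MvPolynomial (Fin 2) ℂ := aeval ![C (z 0), X 0, X 1] c
  have hc' : ∀ x : Fin 2 → ℂ, eval x c' = eval ![z 0, x 0, x 1] c := fun x => by
    change ((aeval x).comp (aeval ![C (z 0), X 0, X 1])) c = aeval _ c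
    congr 1
    ext i; fin_cases i <;> simp
  have hc'0 : c' ≠ 0 := fun h => hcz <| by
    rw [← (by ext i; fin_cases i <;> simp : ![z 0, ![z 1, z 2] 0, ![z 1, z 2] 1] = z),
      ← hc', h, map_zero]
  refine ⟨z 0, hη, ?_⟩
  filter_upwards [eventually_exists_eval_smul_ne_zero hc'0] with u ⟨l, hl, hu⟩
  refine ⟨l, hl, ?_⟩
  rw [hc'] at hu
  set φ := eval ![z 0, (l • u.rep) 0, (l • u.rep) 1] with hφ
  have h := congrArg (Polynomial.map φ) habc
  simp only [Polynomial.map_add, Polynomial.map_mul, Polynomial.map_C] at h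
  rw [← map_polyEquiv, ← hφ]
  refine ⟨Polynomial.C (φ c)⁻¹ * a.map φ, Polynomial.C (φ c)⁻¹ * b.map φ, ?_⟩
  rw [mul_assoc, mul_assoc, ← mul_add, h, ← Polynomial.C_mul, inv_mul_cancel₀ hu, Polynomial.C_1]

theorem eventually_disjoint_fibers {F G : MvPolynomial (Fin 2 ⊕ Fin 2) ℂ} (hF : Bihom F)
    (hG : Bihom G) (hirrF : Irreducible F) (hirrG : Irreducible G) (hx : 0 < xdeg F)
    (hy : 0 < ydeg F) (hFG : ¬ Associated F G) :
    ∀ᶠ u : Pt 2 in Filter.cofinite, ∀ v : Pt 2,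
      eval (Sum.elim u.rep v.rep) F = 0 → eval (Sum.elim u.rep v.rep) G ≠ 0 := by
  have hndvd : ¬ polyEquiv F ∣ polyEquiv G := fun h =>
    hFG (hirrF.associated_of_dvd hirrG ((map_dvd_iff polyEquiv).1 h))
  obtain ⟨η, hη, hcop⟩ := exists_eventually_isCoprime hF hirrF hx hy hndvd
  filter_upwards [hcop, hF.eventually_eval_ne_zero hirrF hx (w := ![1, 0]) (by simp)]
    with u ⟨c, hc, hu⟩ hinf v hvF hvG
  rw [map_polyEquiv] at hu
  rcases Pt.exists_smul_rep_eq_or hη v with ⟨d, t, hd, h⟩ | ⟨d, hd, h⟩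
  · rw [← hF.eval_smul_eq_zero_iff hc hd, h, ← eval_fiberPoly] at hvF
    rw [← hG.eval_smul_eq_zero_iff hc hd, h, ← eval_fiberPoly] at hvG
    obtain ⟨a, b, hab⟩ := hu
    simpa [hvF, hvG] using congrArg (Polynomial.eval t) hab
  · rw [← hF.eval_smul_eq_zero_iff one_ne_zero hd, h, one_smul] at hvF
    exact hinf hvF

theorem eventually_ncard_fiber {F : MvPolynomial (Fin 2 ⊕ Fin 2) ℂ} (hF : Bihom F)
    (hirr : Irreducible F) (hx : 0 < xdeg F) (hy : 0 < ydeg F) :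
    ∀ᶠ u : Pt 2 in Filter.cofinite,
      {v : Pt 2 | eval (Sum.elim u.rep v.rep) F = 0}.Finite ∧
      {v : Pt 2 | eval (Sum.elim u.rep v.rep) F = 0}.ncard = ydeg F := by
  have hdeg := natDegree_polyEquiv_ne_zero hF hirr hx hy
  have hndvd : ¬ polyEquiv F ∣ (polyEquiv F).derivative := fun h => by
    have h0 : (polyEquiv F).derivative ≠ 0 := fun h0 =>
      hdeg (Polynomial.derivative_eq_zero.1 h0)
    exact (Polynomial.natDegree_le_of_dvd h h0).not_gt (Polynomial.natDegree_derivative_lt hdeg)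
  obtain ⟨η, hη, hcop⟩ := exists_eventually_isCoprime hF hirr hx hy hndvd
  filter_upwards [hcop, hF.eventually_eval_ne_zero hirr hx (w := ![1, 0]) (by simp)]
    with u ⟨c, hc, hu⟩ hinf
  rw [← Polynomial.derivative_map, map_polyEquiv] at hu
  set p := fiberPoly η (c • u.rep) F with hp
  have hp0 : p ≠ 0 := by
    intro h0
    rw [h0, Polynomial.derivative_zero] at hu
    exact not_isCoprime_zero_zero hu
  have hset : {v : Pt 2 | eval (Sum.elim u.rep v.rep) F = 0} =
      (fun t => Projectivization.mk ℂ _ (affine_ne_zero hη t)) '' (p.rootSet ℂ) := by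
    ext v
    simp only [Set.mem_ofPred_eq, Set.mem_image, Polynomial.mem_rootSet_of_ne hp0,
      Polynomial.coe_aeval_eq_eval]
    constructor
    · intro hv
      rcases Pt.exists_smul_rep_eq_or hη v with ⟨d, t, hd, h⟩ | ⟨d, hd, h⟩
      · refine ⟨t, ?_, (Pt.eq_mk_of_smul_rep _ h).symm⟩
        rwa [hp, eval_fiberPoly, ← h, hF.eval_smul_eq_zero_iff hc hd]
      · rw [← hF.eval_smul_eq_zero_iff one_ne_zero hd, h, one_smul] at hv
        exact absurd hv hinf
    · rintro ⟨t, ht, rfl⟩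
      obtain ⟨a, ha⟩ := Projectivization.exists_smul_eq_mk_rep ℂ _ (affine_ne_zero hη t)
      rw [hp, eval_fiberPoly] at ht
      rwa [← ha, ← hF.eval_smul_eq_zero_iff hc one_ne_zero, one_smul, Units.smul_def,
        ← one_smul ℂ (c • u.rep), hF.eval_smul_eq_zero_iff one_ne_zero a.ne_zero]
  have hinj : Function.Injective
      (fun t => Projectivization.mk ℂ _ (affine_ne_zero hη t)) := by
    intro s t hst
    obtain ⟨a, ha⟩ := (Projectivization.mk_eq_mk_iff' ℂ _ _ _ _).1 hst
    have h0 := congrFun ha 0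
    have h1 := congrFun ha 1
    simp only [Pi.smul_apply, Matrix.cons_val_zero, Matrix.cons_val_one, smul_eq_mul] at h0 h1
    rw [← h0, (mul_eq_right₀ hη).1 h1, one_mul]
  rw [hset]
  refine ⟨(p.rootSet_finite ℂ).image _, ?_⟩
  rw [Set.ncard_image_of_injective _ hinj, ← Nat.card_coe_set_eq, Nat.card_eq_fintype_card,
    Polynomial.card_rootSet_eq_natDegree hu (IsAlgClosed.splits _)]
  have hinf' := (hF.eval_smul_eq_zero_iff hc one_ne_zero _ _).not.2 hinf
  obtain ⟨a, b, ha, hb⟩ := hF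
  rw [one_smul, ← coeff_fiberPoly hb η] at hinf'
  rw [show ydeg F = b from hb.weightedTotalDegree_eq hirr.ne_zero]
  exact (natDegree_fiberPoly_le hb _ _).antisymm (Polynomial.le_natDegree_of_ne_zero hinf')

/-- With `F = f(x)·g(y)·h₁^{r₁}⋯h_n^{r_n}` as in Theorem 3.1 of the paper
and `M := |{g = 0} ∩ Y| + d₁ + ⋯ + d_n` (`dᵢ = deg_y hᵢ`), for all but finitely many
`u ∈ ℙ¹` the set `{v ∈ Y : F(u,v) = 0}` has exactly `M` elements. -/
theorem stmt1
    (F : MvPolynomial (Fin 2 ⊕ Fin 2) ℂ) (hF0 : F ≠ 0) (hFbh : Bihom F)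
    (Y : Set (Pt 2)) (hY : ZarOpen Y) (hYne : Y.Nonempty)
    (f g : MvPolynomial (Fin 2) ℂ)
    (hf : ∃ d, f.IsHomogeneous d) (hg : ∃ d, g.IsHomogeneous d)
    (n : ℕ) (h : Fin n → MvPolynomial (Fin 2 ⊕ Fin 2) ℂ) (r : Fin n → ℕ)
    (hirr : ∀ i, Irreducible (h i))
    (hbh : ∀ i, Bihom (h i))
    (hxpos : ∀ i, 0 < xdeg (h i)) (hypos : ∀ i, 0 < ydeg (h i))
    (hnassoc : ∀ i j, i ≠ j → ¬ Associated (h i) (h j))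
    (hr : ∀ i, 1 ≤ r i)
    (hfact : F = rename Sum.inl f * rename Sum.inr g * ∏ i, h i ^ r i)
    (M : ℕ) (hM : M = {q ∈ Y | eval q.rep g = 0}.ncard + ∑ i, ydeg (h i)) :
    ∃ E : Set (Pt 2), E.Finite ∧ ∀ u : Pt 2, u ∉ E →
      {v ∈ Y | eval (Sum.elim u.rep v.rep) F = 0}.Finite ∧
      {v ∈ Y | eval (Sum.elim u.rep v.rep) F = 0}.ncard = M := by
  classical
  have hf0 : f ≠ 0 := by
    rintro rfl
    simp [hfact] at hF0
  have hg0 : g ≠ 0 := by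
    rintro rfl
    simp [hfact] at hF0
  have hB : {v : Pt 2 | v ∉ Y ∨ eval v.rep g = 0}.Finite := by
    obtain ⟨d, hd⟩ := hg
    have : ∀ᶠ v : Pt 2 in Filter.cofinite, ¬ (v ∉ Y ∨ eval v.rep g = 0) := by
      filter_upwards [hY.eventually_mem hYne, eventually_exists_eval_smul_ne_zero hg0]
        with v hv ⟨c, hc, hgv⟩
      rw [ne_eq, hd.eval_smul_eq_zero_iff hc] at hgv
      tauto
    simpa only [Filter.eventually_cofinite, not_not] using this
  have hev : ∀ᶠ u : Pt 2 in Filter.cofinite,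
      {v ∈ Y | eval (Sum.elim u.rep v.rep) F = 0}.Finite ∧
      {v ∈ Y | eval (Sum.elim u.rep v.rep) F = 0}.ncard = M := by
    filter_upwards [eventually_exists_eval_smul_ne_zero hf0,
      Filter.eventually_all.2 fun i =>
        eventually_ncard_fiber (hbh i) (hirr i) (hxpos i) (hypos i),
      Filter.eventually_all.2 fun i => Filter.eventually_all.2 fun j =>
        Filter.eventually_all.2 fun hij : i ≠ j =>
          eventually_disjoint_fibers (hbh i) (hbh j) (hirr i) (hirr j) (hxpos i) (hypos i)
            (hnassoc i j hij),
      Filter.eventually_all.2 fun i => (Filter.eventually_all_finite hB).2 fun v _ =>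
        (hbh i).eventually_eval_ne_zero (hirr i) (hxpos i) v.rep_nonzero]
      with u ⟨c, hc, hfu⟩ hcard hdisj hbad
    obtain ⟨d, hd⟩ := hf
    rw [ne_eq, hd.eval_smul_eq_zero_iff hc] at hfu
    have hset : {v ∈ Y | eval (Sum.elim u.rep v.rep) F = 0} =
        {v ∈ Y | eval v.rep g = 0} ∪
          ⋃ i, {v : Pt 2 | eval (Sum.elim u.rep v.rep) (h i) = 0} := by
      ext v
      have hFv : eval (Sum.elim u.rep v.rep) F = 0 ↔
          eval v.rep g = 0 ∨ ∃ i, eval (Sum.elim u.rep v.rep) (h i) = 0 := by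
        have hr' : ∀ i, r i ≠ 0 := fun i => Nat.one_le_iff_ne_zero.1 (hr i)
        simp [hfact, eval_rename, map_prod, Finset.prod_eq_zero_iff, hfu, hr']
      simp only [Set.mem_ofPred_eq, Set.mem_union, Set.mem_iUnion, hFv]
      constructor
      · tauto
      · rintro (hv | ⟨i, hi⟩)
        · tauto
        · exact ⟨by_contra fun hv => hbad i v (Or.inl hv) hi, Or.inr ⟨i, hi⟩⟩
    have hfin₁ : {v ∈ Y | eval v.rep g = 0}.Finite := hB.subset fun v hv => Or.inr hv.2
    have hfin₂ := Set.finite_iUnion fun i => (hcard i).1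
    rw [hset]
    refine ⟨hfin₁.union hfin₂, ?_⟩
    rw [Set.ncard_union_eq ?_ hfin₁ hfin₂, Set.ncard_iUnion_of_finite (fun i => (hcard i).1),
      finsum_eq_sum_of_fintype, hM]
    · simp only [fun i => (hcard i).2]
    · intro i j hij
      exact Set.disjoint_left.2 fun v hvi hvj => hdisj i j hij v hvi hvj
    · refine Set.disjoint_left.2 fun v hv hv' => ?_
      obtain ⟨i, hi⟩ := Set.mem_iUnion.1 hv'
      exact hbad i v (Or.inr hv.2) hi
  exact ⟨_, Filter.eventually_cofinite.1 hev, fun u hu => not_not.1 hu⟩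
end
end

section
/- Let F ∈ ℂ[x₀,x₁,y₀,y₁] be a nonzero bihomogeneous polynomial, let H = {F = 0} ⊆ ℙ¹ × ℙ¹, let X, Y be nonempty Zariski-open subsets of ℙ¹, and let t ≥ 1 be an integer. If H ∩ (X × Y) is (1,t)-grid-free, then there exists a bihomogeneous polynomial F' ∈ ℂ[x₀,x₁,y₀,y₁] whose degree in the y-variables is strictly less than t such that H ∩ (X × Y) = {F' = 0} ∩ (X × Y). -/
open MvPolynomial

noncomputable section

section WeightedHomogeneous

variable {σ : Type*} {w : σ → ℕ} {n : ℕ} {P : MvPolynomial σ ℂ}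

lemma eval_pow_mul_of_isWeightedHomogeneous (h : P.IsWeightedHomogeneous w n) (c : ℂ)
    (x : σ → ℂ) : eval (fun i => c ^ w i * x i) P = c ^ n * eval x P := by
  rw [eval_eq, eval_eq, Finset.mul_sum]
  refine Finset.sum_congr rfl fun d hd => ?_
  rw [← h (mem_support_iff.mp hd), Finsupp.weight_apply, Finsupp.sum, ← Finset.prod_pow_eq_pow_sum]
  simp only [mul_pow, Finset.prod_mul_distrib, smul_eq_mul, ← pow_mul]
  simp only [mul_comm, mul_left_comm]

/-- Multiply every variable by the power of a new variable prescribed by its weight. -/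
def weightScale (w : σ → ℕ) : MvPolynomial σ ℂ →ₐ[ℂ] Polynomial (MvPolynomial σ ℂ) :=
  aeval fun i => Polynomial.C (X i) * Polynomial.X ^ w i

lemma coeff_coeff_weightScale (P : MvPolynomial σ ℂ) (k : ℕ) (d : σ →₀ ℕ) :
    ((weightScale w P).coeff k).coeff d = if Finsupp.weight w d = k then P.coeff d else 0 := by
  classical
  induction P using MvPolynomial.induction_on' with
  | monomial u a =>
    have : weightScale w (monomial u a) =
        Polynomial.monomial (Finsupp.weight w u) (monomial u a) := by
      rw [weightScale, aeval_monomial, ← Polynomial.C_mul_X_pow_eq_monomial, Finsupp.weight_apply,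
        monomial_eq, Finsupp.prod, Finsupp.prod, Finsupp.sum, ← Finset.prod_pow_eq_pow_sum]
      simp only [mul_pow, Finset.prod_mul_distrib, map_mul, map_prod, map_pow, smul_eq_mul,
        ← pow_mul, mul_comm (w _), mul_assoc]
      rfl
    rw [this, Polynomial.coeff_monomial, coeff_monomial]
    split_ifs <;> aesop
  | add p q hp hq =>
    rw [map_add, Polynomial.coeff_add, coeff_add, hp, hq, coeff_add]
    split_ifs <;> simp

lemma isWeightedHomogeneous_iff_weightScale :
    P.IsWeightedHomogeneous w n ↔ weightScale w P = Polynomial.monomial n P := by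
  constructor
  · intro h
    ext k d
    rw [coeff_coeff_weightScale, Polynomial.coeff_monomial]
    by_cases hd : P.coeff d = 0
    · split_ifs <;> simp [hd]
    · rw [h hd]
      split_ifs <;> simp
  · intro h d hd
    by_contra hne
    have := coeff_coeff_weightScale (w := w) P n d
    rw [h, Polynomial.coeff_monomial_same, if_neg hne] at this
    exact hd this

lemma weightScale_ne_zero (hP : P ≠ 0) : weightScale w P ≠ 0 := by
  obtain ⟨d, hd⟩ := ne_zero_iff.mp hP
  intro h
  have := coeff_coeff_weightScale (w := w) P (Finsupp.weight w d) d
  rw [h, if_pos rfl] at this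
  exact hd (by simpa using this.symm)

lemma exists_isWeightedHomogeneous_of_dvd {F : MvPolynomial σ ℂ} (hF : F ≠ 0)
    (h : F.IsWeightedHomogeneous w n) (hPF : P ∣ F) : ∃ m, P.IsWeightedHomogeneous w m := by
  obtain ⟨Q, rfl⟩ := hPF
  have hP := weightScale_ne_zero (w := w) (left_ne_zero_of_mul hF)
  have hQ := weightScale_ne_zero (w := w) (right_ne_zero_of_mul hF)
  have h1 := isWeightedHomogeneous_iff_weightScale.mp h
  rw [map_mul] at h1
  have hdeg := congrArg Polynomial.natDegree h1
  have htr := congrArg Polynomial.natTrailingDegree h1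
  rw [Polynomial.natDegree_mul hP hQ, Polynomial.natDegree_monomial_eq _ hF] at hdeg
  rw [Polynomial.natTrailingDegree_mul hP hQ, Polynomial.natTrailingDegree_monomial hF] at htr
  have hle := Polynomial.natTrailingDegree_le_natDegree (weightScale w P)
  have hle' := Polynomial.natTrailingDegree_le_natDegree (weightScale w Q)
  refine ⟨(weightScale w P).natDegree, fun {d} hd => ?_⟩
  have hne : (weightScale w P).coeff (Finsupp.weight w d) ≠ 0 := by
    intro h0
    have := coeff_coeff_weightScale (w := w) P (Finsupp.weight w d) d
    rw [h0, if_pos rfl] at this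
    exact hd (by simpa using this.symm)
  have h2 := Polynomial.le_natDegree_of_ne_zero hne
  have h3 := Polynomial.natTrailingDegree_le_of_ne_zero hne
  omega

end WeightedHomogeneous

section Bihomogeneous

variable {n : ℕ} {F P : MvPolynomial (Fin n ⊕ Fin n) ℂ}

lemma eval_smul_smul {a b : ℕ} (hx : P.IsWeightedHomogeneous (wx n) a)
    (hy : P.IsWeightedHomogeneous (wy n) b) (c d : ℂ) (x y : Fin n → ℂ) :
    eval (Sum.elim (c • x) (d • y)) P = c ^ a * d ^ b * eval (Sum.elim x y) P := by
  rw [mul_assoc, ← eval_pow_mul_of_isWeightedHomogeneous hy,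
    ← eval_pow_mul_of_isWeightedHomogeneous hx]
  congr 2
  ext (i | i) <;> simp [wx, wy]

lemma Bihom.of_dvd (hF : F ≠ 0) (h : Bihom F) (hPF : P ∣ F) : Bihom P := by
  obtain ⟨a, b, ha, hb⟩ := h
  obtain ⟨a', ha'⟩ := exists_isWeightedHomogeneous_of_dvd hF ha hPF
  obtain ⟨b', hb'⟩ := exists_isWeightedHomogeneous_of_dvd hF hb hPF
  exact ⟨a', b', ha', hb'⟩

lemma Bihom.prod {ι : Type*} (s : Finset ι) (f : ι → MvPolynomial (Fin n ⊕ Fin n) ℂ)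
    (h : ∀ i ∈ s, Bihom (f i)) : Bihom (∏ i ∈ s, f i) := by
  classical
  induction s using Finset.induction_on with
  | empty =>
    exact ⟨0, 0, by simpa using isWeightedHomogeneous_one ℂ _,
      by simpa using isWeightedHomogeneous_one ℂ _⟩
  | insert i s hi ih =>
    rw [Finset.prod_insert hi]
    obtain ⟨a, b, ha, hb⟩ := h i (Finset.mem_insert_self i s)
    obtain ⟨a', b', ha', hb'⟩ := ih fun j hj => h j (Finset.mem_insert_of_mem hj)
    exact ⟨a + a', b + b', ha.mul ha', hb.mul hb'⟩

lemma isWeightedHomogeneous_ydeg {b : ℕ} (hP : P ≠ 0) (h : P.IsWeightedHomogeneous (wy n) b) :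
    ydeg P = b := by
  have h1 := h.weighted_total_degree hP
  rw [weightedTotalDegree_coe _ _ hP] at h1
  exact WithBot.coe_injective h1

lemma Bihom.isWeightedHomogeneous_wy (h : Bihom P) (hP : P ≠ 0) :
    P.IsWeightedHomogeneous (wy n) (ydeg P) := by
  obtain ⟨a, b, -, hb⟩ := h
  rwa [isWeightedHomogeneous_ydeg hP hb]

lemma ydeg_prod {ι : Type*} (s : Finset ι) (f : ι → MvPolynomial (Fin n ⊕ Fin n) ℂ)
    (h : ∀ i ∈ s, Bihom (f i)) (h0 : ∀ i ∈ s, f i ≠ 0) :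
    ydeg (∏ i ∈ s, f i) = ∑ i ∈ s, ydeg (f i) := by
  refine isWeightedHomogeneous_ydeg (Finset.prod_ne_zero_iff.mpr h0) ?_
  exact IsWeightedHomogeneous.prod s f _ fun i hi => (h i hi).isWeightedHomogeneous_wy (h0 i hi)

lemma Bihom.mem_zeroSet_mk_iff (h : Bihom P) {x y : Fin n → ℂ} (hx : x ≠ 0) (hy : y ≠ 0) :
    (Projectivization.mk ℂ x hx, Projectivization.mk ℂ y hy) ∈ zeroSet P ↔
      eval (Sum.elim x y) P = 0 := by
  obtain ⟨a, b, ha, hb⟩ := h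
  obtain ⟨c, hc⟩ := Projectivization.exists_smul_eq_mk_rep ℂ x hx
  obtain ⟨d, hd⟩ := Projectivization.exists_smul_eq_mk_rep ℂ y hy
  change eval (Sum.elim (Projectivization.mk ℂ x hx).rep (Projectivization.mk ℂ y hy).rep) P = 0 ↔ _
  rw [← hc, ← hd, Units.smul_def, Units.smul_def, eval_smul_smul ha hb]
  simp

lemma eval_rep_mk_eq_zero_iff_s2 {m : ℕ} {g : MvPolynomial (Fin n) ℂ} (h : g.IsHomogeneous m)
    {x : Fin n → ℂ} (hx : x ≠ 0) :
    eval (Projectivization.mk ℂ x hx).rep g = 0 ↔ eval x g = 0 := by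
  obtain ⟨c, hc⟩ := Projectivization.exists_smul_eq_mk_rep ℂ x hx
  have := eval_pow_mul_of_isWeightedHomogeneous h c x
  simp only [Pi.one_apply, pow_one] at this
  rw [← hc, Units.smul_def]
  change eval (fun i => (c : ℂ) * x i) g = 0 ↔ _
  rw [this]
  simp

end Bihomogeneous

/-- The isomorphism `ℂ[x₀,x₁,y₀,y₁] ≃ ℂ[x₀,x₁,u][z]` given by `y₀ = u + l z`, `y₁ = z`. -/
def shearEquiv (l : ℂ) :
    MvPolynomial (Fin 2 ⊕ Fin 2) ℂ ≃ₐ[ℂ] Polynomial (MvPolynomial (Fin 3) ℂ) :=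
  AlgEquiv.ofAlgHom
    (aeval (Sum.elim ![Polynomial.C (X 0), Polynomial.C (X 1)]
      ![Polynomial.C (X 2) + Polynomial.C (C l) * Polynomial.X, Polynomial.X]))
    (Polynomial.eval₂AlgHom
      (aeval ![X (Sum.inl 0), X (Sum.inl 1), X (Sum.inr 0) - C l * X (Sum.inr 1)])
      (X (Sum.inr 1)) fun _ => Commute.all _ _)
    (by
      refine Polynomial.algHom_ext' (MvPolynomial.algHom_ext fun i => ?_) (by simp)
      fin_cases i <;> simp [MvPolynomial.algebraMap_eq])
    (by
      ext i : 1
      rcases i with i | i <;> fin_cases i <;> simp)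

lemma eval_map_shearEquiv (l : ℂ) (P : MvPolynomial (Fin 2 ⊕ Fin 2) ℂ) (a : Fin 3 → ℂ) (z : ℂ) :
    ((shearEquiv l P).map (eval a)).eval z =
      eval (Sum.elim ![a 0, a 1] ![a 2 + l * z, z]) P := by
  have : ((Polynomial.evalRingHom z).comp ((Polynomial.mapRingHom (eval a)).comp
      (shearEquiv l : _ →+* _))) = eval (Sum.elim ![a 0, a 1] ![a 2 + l * z, z]) := by
    ext i
    · simp [shearEquiv]
    · rcases i with i | i <;> fin_cases i <;> simp [shearEquiv]
  exact congrArg (fun f => f P) this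

section Gauss

variable {A : Type*} [CommRing A] [IsDomain A] [UniqueFactorizationMonoid A]

lemma exists_mul_add_mul_eq_C {p q : Polynomial A} (hp : Irreducible p) (hdeg : p.natDegree ≠ 0)
    (hpq : ¬ p ∣ q) : ∃ c : A, c ≠ 0 ∧ ∃ u v : Polynomial A, u * p + v * q = Polynomial.C c := by
  let : StrongNormalizationMonoid A := UniqueFactorizationMonoid.strongNormalizationMonoid
  let : NormalizedGCDMonoid A := UniqueFactorizationMonoid.toNormalizedGCDMonoid A
  let K := FractionRing A
  have hprim := hp.isPrimitive hdeg
  have hirr := hprim.irreducible_iff_irreducible_map_fraction_map (K := K) |>.mp hp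
  have hndvd := mt (hprim.dvd_of_fraction_map_dvd_fraction_map (K := K)) hpq
  obtain ⟨u, v, huv⟩ := (hirr.coprime_iff_not_dvd).mpr hndvd
  obtain ⟨b, hb, hb'⟩ := IsLocalization.integerNormalization_spec (nonZeroDivisors A) u
  obtain ⟨c, hc, hc'⟩ := IsLocalization.integerNormalization_spec (nonZeroDivisors A) v
  set u' := IsLocalization.integerNormalization (nonZeroDivisors A) u
  set v' := IsLocalization.integerNormalization (nonZeroDivisors A) v
  refine ⟨b * c, mul_ne_zero (nonZeroDivisors.ne_zero hb) (nonZeroDivisors.ne_zero hc),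
    Polynomial.C c * u', Polynomial.C b * v', ?_⟩
  apply Polynomial.map_injective _ (IsFractionRing.injective A K)
  simp only [Polynomial.map_add, Polynomial.map_mul, Polynomial.map_C, hb', hc',
    Algebra.smul_def, Polynomial.algebraMap_apply, map_mul]
  linear_combination (Polynomial.C (algebraMap A K b) * Polynomial.C (algebraMap A K c)) * huv

end Gauss

lemma exists_finset_irreducible_factors {R : Type*} [CommRing R] [IsDomain R]
    [UniqueFactorizationMonoid R] {F : R} (hF : F ≠ 0) :
    ∃ N : Finset R, (∀ P ∈ N, Irreducible P ∧ P ∣ F) ∧ (∀ P ∈ N, ∀ Q ∈ N, P ∣ Q → P = Q) ∧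
      ∀ f : R →+* ℂ, f F = 0 → ∃ P ∈ N, f P = 0 := by
  classical
  let : StrongNormalizationMonoid R := UniqueFactorizationMonoid.strongNormalizationMonoid
  refine ⟨(UniqueFactorizationMonoid.normalizedFactors F).toFinset, fun P hP => ?_,
    fun P hP Q hQ hPQ => ?_, fun f hf => ?_⟩
  · rw [Multiset.mem_toFinset] at hP
    exact ⟨UniqueFactorizationMonoid.irreducible_of_normalized_factor P hP,
      UniqueFactorizationMonoid.dvd_of_mem_normalizedFactors hP⟩
  · rw [Multiset.mem_toFinset] at hP hQ
    exact UniqueFactorizationMonoid.mem_normalizedFactors_eq_of_associated hP hQ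
      ((UniqueFactorizationMonoid.irreducible_of_normalized_factor P hP).associated_of_dvd
        (UniqueFactorizationMonoid.irreducible_of_normalized_factor Q hQ) hPQ)
  · obtain ⟨u, hu⟩ := UniqueFactorizationMonoid.prod_normalizedFactors hF
    rw [← hu, map_mul, mul_eq_zero, map_multiset_prod, Multiset.prod_eq_zero_iff] at hf
    rcases hf with hf | hf
    · obtain ⟨P, hP, hP0⟩ := Multiset.mem_map.mp hf
      exact ⟨P, Multiset.mem_toFinset.mpr hP, hP0⟩
    · exact absurd hf (u.isUnit.map f).ne_zero

section Generic

variable {σ : Type*}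

lemma exists_eval_ne_zero {P : MvPolynomial σ ℂ} (hP : P ≠ 0) : ∃ a, eval a P ≠ 0 := by
  by_contra! h
  exact hP (MvPolynomial.funext fun a => by simp [h a])

/-- A property of points of affine space that holds off some hypersurface. -/
def Generic (p : (σ → ℂ) → Prop) : Prop :=
  ∃ c : MvPolynomial σ ℂ, c ≠ 0 ∧ ∀ a, eval a c ≠ 0 → p a

lemma Generic.exists {p : (σ → ℂ) → Prop} (h : Generic p) : ∃ a, p a := by
  obtain ⟨c, hc, h⟩ := h
  obtain ⟨a, ha⟩ := exists_eval_ne_zero hc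
  exact ⟨a, h a ha⟩

lemma generic_eval_ne_zero {c : MvPolynomial σ ℂ} (hc : c ≠ 0) :
    Generic fun a => eval a c ≠ 0 := ⟨c, hc, fun _ => id⟩

lemma Generic.and {p q : (σ → ℂ) → Prop} (hp : Generic p) (hq : Generic q) :
    Generic fun a => p a ∧ q a := by
  obtain ⟨c, hc, hp⟩ := hp
  obtain ⟨d, hd, hq⟩ := hq
  refine ⟨c * d, mul_ne_zero hc hd, fun a ha => ?_⟩
  rw [map_mul] at ha
  exact ⟨hp a (left_ne_zero_of_mul ha), hq a (right_ne_zero_of_mul ha)⟩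

lemma Generic.forall_mem {ι : Type*} {s : Finset ι} {p : ι → (σ → ℂ) → Prop}
    (h : ∀ i ∈ s, Generic (p i)) : Generic fun a => ∀ i ∈ s, p i a := by
  classical
  induction s using Finset.induction_on with
  | empty => exact ⟨1, one_ne_zero, by simp⟩
  | insert i s hi ih =>
    simp only [Finset.forall_mem_insert] at h ⊢
    exact h.1.and (ih h.2)

variable {p q : Polynomial (MvPolynomial σ ℂ)}

lemma generic_isCoprime_map (hp : Irreducible p) (hdeg : p.natDegree ≠ 0) (hpq : ¬ p ∣ q) :
    Generic fun a => IsCoprime (p.map (eval a)) (q.map (eval a)) := by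
  obtain ⟨c, hc, u, v, huv⟩ := exists_mul_add_mul_eq_C hp hdeg hpq
  refine ⟨c, hc, fun a ha => ?_⟩
  refine ⟨Polynomial.C (eval a c)⁻¹ * u.map (eval a), Polynomial.C (eval a c)⁻¹ * v.map (eval a),
    ?_⟩
  have h := congrArg (Polynomial.map (eval a)) huv
  simp only [Polynomial.map_add, Polynomial.map_mul, Polynomial.map_C] at h
  have h1 : Polynomial.C (eval a c)⁻¹ * Polynomial.C (eval a c) = 1 := by
    rw [← Polynomial.C_mul, inv_mul_cancel₀ ha, Polynomial.C_1]
  linear_combination Polynomial.C (eval a c)⁻¹ * h + h1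

lemma generic_separable_map (hp : Irreducible p) (hdeg : p.natDegree ≠ 0) :
    Generic fun a => (p.map (eval a)).Separable := by
  have h : ¬ p ∣ Polynomial.derivative p :=
    Polynomial.not_dvd_of_natDegree_lt (mt Polynomial.derivative_eq_zero.mp hdeg)
      (Polynomial.natDegree_derivative_lt hdeg)
  simpa only [Polynomial.Separable, Polynomial.derivative_map] using
    generic_isCoprime_map hp hdeg h

end Generic

lemma shear_ne_zero {l s : ℂ} (hs : s ≠ 0) (z : ℂ) : ![s + l * z, z] ≠ 0 := by
  intro h
  have h0 := congrFun h 0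
  have h1 := congrFun h 1
  simp only [Matrix.cons_val_zero, Matrix.cons_val_one, Pi.zero_apply] at h0 h1
  rw [h1] at h0
  exact hs (by simpa using h0)

lemma mk_shear_injective {l s : ℂ} (hs : s ≠ 0) :
    Function.Injective fun z : ℂ => Projectivization.mk ℂ ![s + l * z, z] (shear_ne_zero hs z) := by
  intro z z' h
  obtain ⟨c, hc⟩ := (Projectivization.mk_eq_mk_iff' _ _ _ _ _).mp h
  have h0 := congrFun hc 0
  have h1 := congrFun hc 1
  simp only [Pi.smul_apply, Matrix.cons_val_zero, Matrix.cons_val_one, smul_eq_mul] at h0 h1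
  have hc1 : c = 1 := mul_right_cancel₀ hs (by linear_combination h0 - l * h1)
  rw [hc1, one_mul] at h1
  exact h1.symm

lemma GridFree.card_lt {α β : Type*} {t : ℕ} {V : Set (α × β)} (h : GridFree 1 t V) (a : α)
    (T : Finset β) (hT : ∀ b ∈ T, (a, b) ∈ V) : T.card < t := by
  by_contra! hle
  obtain ⟨T', hT', hcard⟩ := Finset.exists_subset_card_eq hle
  exact h ⟨{a}, T', by simp, hcard, fun a' ha' b hb => by
    rw [Finset.mem_singleton.mp ha']
    exact hT b (hT' hb)⟩

lemma natDegree_shearEquiv_ge {l : ℂ} {x : Fin 2 → ℂ} {P : MvPolynomial (Fin 2 ⊕ Fin 2) ℂ}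
    (hP : Bihom P) (h : eval (Sum.elim x ![l, 1]) P ≠ 0) :
    ydeg P ≤ (shearEquiv l P).natDegree := by
  have hP0 : P ≠ 0 := by
    rintro rfl
    simp at h
  obtain ⟨a, b, ha, hb⟩ := hP
  rw [isWeightedHomogeneous_ydeg hP0 hb]
  have key : (shearEquiv l P).map (eval ![x 0, x 1, 0]) =
      Polynomial.C (eval (Sum.elim x ![l, 1]) P) * Polynomial.X ^ b := by
    refine Polynomial.funext fun z => ?_
    have := eval_smul_smul ha hb 1 z x ![l, 1]
    rw [eval_map_shearEquiv]
    simp only [Polynomial.eval_mul, Polynomial.eval_C, Polynomial.eval_pow, Polynomial.eval_X]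
    rw [one_pow, one_mul, mul_comm] at this
    rw [← this]
    congr 2
    ext (i | i) <;> fin_cases i <;> simp [mul_comm]
  calc b = ((shearEquiv l P).map (eval ![x 0, x 1, 0])).natDegree := by
        rw [key, Polynomial.natDegree_C_mul_X_pow _ _ h]
    _ ≤ _ := Polynomial.natDegree_map_le

lemma exists_shear_eval_ne_zero {F : MvPolynomial (Fin 2 ⊕ Fin 2) ℂ} (hF0 : F ≠ 0)
    (hF : Bihom F) : ∃ (l : ℂ) (x : Fin 2 → ℂ), eval (Sum.elim x ![l, 1]) F ≠ 0 := by
  obtain ⟨v, hv⟩ := exists_eval_ne_zero (mul_ne_zero hF0 (X_ne_zero (Sum.inr 1)))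
  rw [map_mul, eval_X] at hv
  refine ⟨v (Sum.inr 0) / v (Sum.inr 1), fun i => v (Sum.inl i), fun h0 => ?_⟩
  obtain ⟨a, b, ha, hb⟩ := hF
  have := eval_smul_smul ha hb 1 (v (Sum.inr 1)) (fun i => v (Sum.inl i))
    ![v (Sum.inr 0) / v (Sum.inr 1), 1]
  rw [h0, mul_zero] at this
  refine left_ne_zero_of_mul hv ?_
  rw [← this]
  congr 2
  have := right_ne_zero_of_mul hv
  ext (i | i) <;> fin_cases i <;> simp
  field_simp

/-- A factor vanishing at some point of `X × Y` involves the `y`-variables, as otherwise a whole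
fibre would be contained in the zero set. -/
lemma ydeg_ne_zero_of_gridFree {F P : MvPolynomial (Fin 2 ⊕ Fin 2) ℂ} (hP : Bihom P) (hP0 : P ≠ 0)
    (hPF : P ∣ F) {X Y : Set (Pt 2)} (hY : ZarOpen Y) {t : ℕ}
    (hgf : GridFree 1 t (zeroSet F ∩ X ×ˢ Y)) {p q : Pt 2} (hp : p ∈ X) (hq : q ∈ Y)
    (hpq : (p, q) ∈ zeroSet P) : ydeg P ≠ 0 := by
  intro hdeg
  obtain ⟨S, hS, rfl⟩ := hY
  obtain ⟨g, hg, hgq⟩ : ∃ g ∈ S, eval q.rep g ≠ 0 := by simpa using hq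
  obtain ⟨d, hgd⟩ := hS g hg
  have hg0 : g ≠ 0 := by
    rintro rfl
    simp at hgq
  have hconst (y : Fin 2 → ℂ) :
      eval (Sum.elim p.rep y) P = eval (Sum.elim p.rep (0 : Fin 2 → ℂ)) P := by
    obtain ⟨a, b, ha, hb⟩ := hP
    rw [isWeightedHomogeneous_ydeg hP0 hb] at hdeg
    have := eval_smul_smul ha hb 1 0 p.rep y
    rw [hdeg, one_smul, zero_smul] at this
    simpa using this.symm
  have hzero (y : Pt 2) : (p, y) ∈ zeroSet F := by
    obtain ⟨Q, rfl⟩ := hPF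
    change eval (Sum.elim p.rep q.rep) P = 0 at hpq
    change eval (Sum.elim p.rep y.rep) (P * Q) = 0
    rw [map_mul, hconst, ← hconst q.rep, hpq, zero_mul]
  obtain ⟨v, hv⟩ := exists_eval_ne_zero (mul_ne_zero hg0 (X_ne_zero 0))
  rw [map_mul, eval_X] at hv
  have hv0 := right_ne_zero_of_mul hv
  let r : Polynomial ℂ := aeval ![Polynomial.C (v 0), Polynomial.X] g
  have hr (z : ℂ) : r.eval z = eval ![v 0, z] g := by
    have : (Polynomial.evalRingHom z).comp
        (aeval ![Polynomial.C (v 0), Polynomial.X] : _ →ₐ[ℂ] Polynomial ℂ).toRingHom =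
        eval ![v 0, z] := by
      ext i
      · simp
      · fin_cases i <;> simp
    exact congrArg (fun f => f g) this
  have hr0 : r ≠ 0 := by
    intro h
    have := hr (v 1)
    rw [h, Polynomial.eval_zero, show ![v 0, v 1] = v by ext i; fin_cases i <;> rfl] at this
    exact left_ne_zero_of_mul hv this.symm
  obtain ⟨Z, hZ, hcard⟩ :=
    (Set.Finite.infinite_compl r.roots.toFinset.finite_toSet).exists_subset_card_eq t
  classical
  have := hgf.card_lt p (Z.map ⟨_, mk_shear_injective (l := 0) hv0⟩) (by
    intro y hy
    obtain ⟨z, hz, rfl⟩ := Finset.mem_map.mp hy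
    refine ⟨hzero _, hp, ?_⟩
    simp only [Set.mem_ofPred_eq, Function.Embedding.coeFn_mk]
    push Not
    refine ⟨g, hg, ?_⟩
    rw [Ne, eval_rep_mk_eq_zero_iff_s2 hgd, zero_mul, add_zero, ← hr]
    intro h0
    exact hZ hz (by simpa [hr0] using h0))
  rw [Finset.card_map, hcard] at this
  exact this.false

/-- A form in the `y`-variables that is nonzero at `q` is not divisible by a polynomial vanishing
at `(p, q)`. -/
lemma not_dvd_rename_inr {P : MvPolynomial (Fin 2 ⊕ Fin 2) ℂ} {g : MvPolynomial (Fin 2) ℂ}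
    {x y : Fin 2 → ℂ} (hP : eval (Sum.elim x y) P = 0) (hg : eval y g ≠ 0) :
    ¬ P ∣ rename Sum.inr g := by
  rintro ⟨Q, hQ⟩
  have := congrArg (eval (Sum.elim x y)) hQ
  rw [eval_rename, map_mul, hP, zero_mul] at this
  exact hg this

/-- Corollary 3.2 of the paper.  If `H ∩ (X × Y)` is `(1,t)`-grid-free,
where `H = {F = 0} ⊆ ℙ¹ × ℙ¹` for a nonzero bihomogeneous `F`, then there is a
bihomogeneous `F'` of degree `< t` in the `y`-variables with
`H ∩ (X × Y) = {F' = 0} ∩ (X × Y)`. -/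
theorem stmt2
    (F : MvPolynomial (Fin 2 ⊕ Fin 2) ℂ) (hF0 : F ≠ 0) (hFbh : Bihom F)
    (X Y : Set (Pt 2)) (hX : ZarOpen X) (hY : ZarOpen Y)
    (hXne : X.Nonempty) (hYne : Y.Nonempty)
    (t : ℕ) (ht : 1 ≤ t)
    (hgf : GridFree 1 t (zeroSet F ∩ X ×ˢ Y)) :
    ∃ F' : MvPolynomial (Fin 2 ⊕ Fin 2) ℂ, Bihom F' ∧ ydeg F' < t ∧
      zeroSet F ∩ X ×ˢ Y = zeroSet F' ∩ X ×ˢ Y := by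
  classical
  obtain ⟨N, hN, hNN, hNF⟩ := exists_finset_irreducible_factors hF0
  let M := N.filter fun P => ∃ p ∈ X, ∃ q ∈ Y, (p, q) ∈ zeroSet P
  have hirr : ∀ P ∈ M, Irreducible P := fun P hP => (hN P (Finset.mem_filter.mp hP).1).1
  have hdvd : ∀ P ∈ M, P ∣ F := fun P hP => (hN P (Finset.mem_filter.mp hP).1).2
  have hbh : ∀ P ∈ M, Bihom P := fun P hP => hFbh.of_dvd hF0 (hdvd P hP)
  have hvan : ∀ P ∈ M, ∀ v, eval v P = 0 → eval v F = 0 := fun P hP v hv => by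
    obtain ⟨Q, hQ⟩ := hdvd P hP
    rw [hQ, map_mul, hv, zero_mul]
  refine ⟨∏ P ∈ M, P, Bihom.prod M _ hbh, ?_, ?_⟩
  swap
  · ext ⟨p, q⟩
    refine and_congr_left fun ⟨hp, hq⟩ => ?_
    change eval (Sum.elim p.rep q.rep) F = 0 ↔ eval (Sum.elim p.rep q.rep) (∏ P ∈ M, P) = 0
    rw [map_prod, Finset.prod_eq_zero_iff]
    constructor
    · intro h
      obtain ⟨P, hP, hP0⟩ := hNF _ h
      exact ⟨P, Finset.mem_filter.mpr ⟨hP, p, hp, q, hq, hP0⟩, hP0⟩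
    · rintro ⟨P, hP, hP0⟩
      exact hvan P hP _ hP0
  obtain ⟨l, x₀, hl⟩ := exists_shear_eval_ne_zero hF0 hFbh
  have hdeg : ∀ P ∈ M, ydeg P ≤ (shearEquiv l P).natDegree := fun P hP =>
    natDegree_shearEquiv_ge (hbh P hP) fun h => hl (hvan P hP _ h)
  have hdeg0 : ∀ P ∈ M, (shearEquiv l P).natDegree ≠ 0 := fun P hP => by
    obtain ⟨-, p, hp, q, hq, hpq⟩ := Finset.mem_filter.mp hP
    have := ydeg_ne_zero_of_gridFree (hbh P hP) (hirr P hP).ne_zero (hdvd P hP) hY hgf hp hq hpq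
    have := hdeg P hP
    omega
  have hirr' : ∀ P ∈ M, Irreducible (shearEquiv l P) := fun P hP =>
    (MulEquiv.irreducible_iff (shearEquiv l)).mpr (hirr P hP)
  obtain ⟨SX, hSX, rfl⟩ := hX
  obtain ⟨SY, hSY, rfl⟩ := hY
  obtain ⟨pX, hpX⟩ := hXne
  obtain ⟨gX, hgX, hgX0⟩ : ∃ g ∈ SX, eval pX.rep g ≠ 0 := by simpa using hpX
  have hgX' : rename ![(0 : Fin 3), 1] gX ≠ 0 := by
    intro h
    have := congrArg (eval ![pX.rep 0, pX.rep 1, 0]) h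
    rw [eval_rename, map_zero] at this
    refine hgX0 ?_
    rw [← this]
    congr 2
    ext i
    fin_cases i <;> rfl
  have hgY : ∀ P ∈ M, ∃ g ∈ SY, ¬ P ∣ rename Sum.inr g := fun P hP => by
    obtain ⟨-, p, hp, q, hq, hpq⟩ := Finset.mem_filter.mp hP
    obtain ⟨g, hg, hg0⟩ : ∃ g ∈ SY, eval q.rep g ≠ 0 := by simpa using hq
    exact ⟨g, hg, not_dvd_rename_inr hpq hg0⟩
  choose! gY hgYS hgY using hgY
  have hcop {P Q : MvPolynomial (Fin 2 ⊕ Fin 2) ℂ} (hP : P ∈ M) (hPQ : ¬ P ∣ Q) :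
      Generic fun a => IsCoprime ((shearEquiv l P).map (eval a)) ((shearEquiv l Q).map (eval a)) :=
    generic_isCoprime_map (hirr' P hP) (hdeg0 P hP) (mt (map_dvd_iff (shearEquiv l)).mp hPQ)
  obtain ⟨a, ha0, ha2, haX, hsep, hlc, hgcop, hpair⟩ :=
    ((generic_eval_ne_zero (X_ne_zero (0 : Fin 3))).and <|
      (generic_eval_ne_zero (X_ne_zero (2 : Fin 3))).and <|
      (generic_eval_ne_zero hgX').and <|
      (Generic.forall_mem fun P hP => generic_separable_map (hirr' P hP) (hdeg0 P hP)).and <|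
      (Generic.forall_mem fun P hP => generic_eval_ne_zero
        (Polynomial.leadingCoeff_ne_zero.mpr (hirr' P hP).ne_zero)).and <|
      (Generic.forall_mem fun P hP => hcop hP (hgY P hP)).and <|
      Generic.forall_mem fun PQ (hPQ : PQ ∈ M.offDiag) => hcop (Finset.mem_offDiag.mp hPQ).1
        fun h => (Finset.mem_offDiag.mp hPQ).2.2 <|
          hNN _ (Finset.mem_filter.mp (Finset.mem_offDiag.mp hPQ).1).1 _
            (Finset.mem_filter.mp (Finset.mem_offDiag.mp hPQ).2.1).1 h).exists
  rw [eval_X] at ha0 ha2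
  let f := ∏ P ∈ M, (shearEquiv l P).map (eval a)
  have hfsep : f.Separable := Polynomial.separable_prod'
    (fun P hP Q hQ hne => hpair (P, Q) (Finset.mem_offDiag.mpr ⟨hP, hQ, hne⟩)) hsep
  have hfdeg : ydeg (∏ P ∈ M, P) ≤ f.roots.toFinset.card := by
    rw [Multiset.toFinset_card_of_nodup (Polynomial.nodup_roots hfsep),
      IsAlgClosed.card_roots_eq_natDegree, Polynomial.natDegree_prod _ _ fun P hP h =>
        (hsep P hP).ne_zero h, ydeg_prod _ _ hbh fun P hP => (hirr P hP).ne_zero]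
    refine Finset.sum_le_sum fun P hP => ?_
    rw [Polynomial.natDegree_map_of_leadingCoeff_ne_zero _ (hlc P hP)]
    exact hdeg P hP
  have hx : ![a 0, a 1] ≠ 0 := fun h => ha0 (congrFun h 0)
  have hcard := hgf.card_lt (Projectivization.mk ℂ _ hx)
    (f.roots.toFinset.map ⟨_, mk_shear_injective (l := l) ha2⟩) (by
      intro y hy
      obtain ⟨z, hz, rfl⟩ := Finset.mem_map.mp hy
      have hz0 := Polynomial.isRoot_of_mem_roots (Multiset.mem_toFinset.mp hz)
      rw [Polynomial.IsRoot.def, Polynomial.eval_prod, Finset.prod_eq_zero_iff] at hz0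
      obtain ⟨P, hP, hPz⟩ := hz0
      refine ⟨?_, ?_, ?_⟩
      · rw [eval_map_shearEquiv] at hPz
        exact (hFbh.mem_zeroSet_mk_iff hx (shear_ne_zero ha2 z)).mpr (hvan P hP _ hPz)
      · simp only [Set.mem_ofPred_eq]
        push Not
        refine ⟨gX, hgX, ?_⟩
        obtain ⟨d, hd⟩ := hSX gX hgX
        rw [Ne, eval_rep_mk_eq_zero_iff_s2 hd]
        rwa [eval_rename, show a ∘ ![0, 1] = ![a 0, a 1] by ext i; fin_cases i <;> rfl] at haX
      · simp only [Set.mem_ofPred_eq, Function.Embedding.coeFn_mk]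
        push Not
        refine ⟨gY P, hgYS P hP, fun h => ?_⟩
        obtain ⟨d, hd⟩ := hSY _ (hgYS P hP)
        rw [eval_rep_mk_eq_zero_iff_s2 hd] at h
        obtain ⟨u, v, huv⟩ := hgcop P hP
        have := congrArg (Polynomial.eval z) huv
        rw [Polynomial.eval_add, Polynomial.eval_mul, Polynomial.eval_mul, hPz,
          eval_map_shearEquiv, eval_rename, Sum.elim_comp_inr, h] at this
        simp at this)
  rw [Finset.card_map] at hcard
  exact hfdeg.trans_lt hcard
end
end

section
/- Let h₁, h₂ ∈ ℂ[x₀,x₁,x₂,y₀,y₁,y₂] be irreducible bihomogeneous polynomials that are not scalar multiples of each other, and suppose each hᵢ has positive degree in the x-variables and positive degree in the y-variables. Then there is a nonempty Zariski-open subset U ⊆ ℙ² such that for every u ∈ U (with any chosen representative vector of u), the polynomials h₁(u, y₀,y₁,y₂) and h₂(u, y₀,y₁,y₂) in ℂ[y₀,y₁,y₂] are both nonzero and have no common nonconstant factor. -/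
open MvPolynomial

noncomputable section

/-- Substituting the vector `u` for the `x`-variables of a polynomial in
`x₀,…,x_{n-1},y₀,…,y_{n-1}` yields a polynomial in the `y`-variables. -/
def sectionPoly {n : ℕ} (F : MvPolynomial (Fin n ⊕ Fin n) ℂ) (u : Fin n → ℂ) :
    MvPolynomial (Fin n) ℂ :=
  aeval (Sum.elim (fun i => MvPolynomial.C (u i)) MvPolynomial.X) F

/-- The products of `H₁` with the monomials of degree less than `b₂`, together with the products
of `H₂` with the monomials of degree less than `b₁`. -/
def monomialMultiples {σ R : Type*} [CommRing R] (H₁ H₂ : MvPolynomial σ R) (b₁ b₂ : ℕ) :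
    {m : σ →₀ ℕ // m.degree < b₂} ⊕ {m : σ →₀ ℕ // m.degree < b₁} → MvPolynomial σ R :=
  Sum.elim (fun m => monomial m.1 1 * H₁) (fun m => monomial m.1 1 * H₂)

theorem map_comp_monomialMultiples {σ R S : Type*} [CommRing R] [CommRing S] (φ : R →+* S)
    (H₁ H₂ : MvPolynomial σ R) (b₁ b₂ : ℕ) :
    map φ ∘ monomialMultiples H₁ H₂ b₁ b₂ =
      monomialMultiples (map φ H₁) (map φ H₂) b₁ b₂ := by
  ext1 (m | m) <;> simp [monomialMultiples]

instance finite_degree_lt {σ : Type*} [Finite σ] (n : ℕ) :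
    Finite {m : σ →₀ ℕ // m.degree < n} :=
  Set.Finite.to_subtype (s := {m : σ →₀ ℕ | m.degree < n})
    ((Finsupp.finite_of_degree_le n).subset fun _ h => Nat.le_of_lt h)

theorem sum_smul_monomial_eq {σ R : Type*} [CommRing R] {b : ℕ}
    [Fintype {m : σ →₀ ℕ // m.degree < b}] {P : MvPolynomial σ R} (hP : P.totalDegree < b) :
    ∑ m : {m : σ →₀ ℕ // m.degree < b}, P.coeff m.1 • monomial m.1 (1 : R) = P := by
  classical
  ext m
  simp only [coeff_sum, coeff_smul, coeff_monomial, smul_eq_mul, mul_ite, mul_one, mul_zero]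
  by_cases hm : m.degree < b
  · rw [Finset.sum_eq_single ⟨m, hm⟩]
    · simp
    · intro k _ hk
      rw [if_neg fun h => hk (Subtype.ext h)]
    · simp
  · rw [Finset.sum_eq_zero, coeff_eq_zero_of_totalDegree_lt]
    · rw [← Finsupp.degree_apply]; omega
    · intro k _
      rw [if_neg]
      rintro rfl
      exact hm k.2

theorem totalDegree_sum_smul_monomial_lt {σ R : Type*} [CommRing R] {b : ℕ}
    [Fintype {m : σ →₀ ℕ // m.degree < b}] (hb : 0 < b)
    (f : {m : σ →₀ ℕ // m.degree < b} → R) :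
    (∑ m, f m • monomial m.1 (1 : R)).totalDegree < b := by
  refine (totalDegree_finsetSum_le (d := b - 1) fun m _ => ?_).trans_lt (by omega)
  refine (totalDegree_smul_le _ _).trans ((totalDegree_monomial_le _ _).trans ?_)
  exact Nat.le_sub_one_of_lt m.2

theorem coeff_sum_smul_monomial {σ R : Type*} [CommRing R] {b : ℕ}
    [Fintype {m : σ →₀ ℕ // m.degree < b}] (f : {m : σ →₀ ℕ // m.degree < b} → R)
    (k : {m : σ →₀ ℕ // m.degree < b}) :
    coeff k.1 (∑ m, f m • monomial m.1 (1 : R)) = f k := by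
  classical
  simp only [coeff_sum, coeff_smul, coeff_monomial, smul_eq_mul, mul_ite, mul_one, mul_zero]
  rw [Finset.sum_eq_single k] <;> simp +contextual [Subtype.ext_iff]

theorem linearIndependent_monomialMultiples_iff {σ R : Type*} [Finite σ] [CommRing R]
    (H₁ H₂ : MvPolynomial σ R) {b₁ b₂ : ℕ} (hb₁ : 0 < b₁) (hb₂ : 0 < b₂) :
    LinearIndependent R (monomialMultiples H₁ H₂ b₁ b₂) ↔
      ∀ P Q : MvPolynomial σ R, P.totalDegree < b₂ → Q.totalDegree < b₁ →
        P * H₁ + Q * H₂ = 0 → P = 0 ∧ Q = 0 := by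
  classical
  have := Fintype.ofFinite {m : σ →₀ ℕ // m.degree < b₁}
  have := Fintype.ofFinite {m : σ →₀ ℕ // m.degree < b₂}
  rw [Fintype.linearIndependent_iff]
  constructor
  · intro h P Q hP hQ hPQ
    have hcoeff := h (Sum.elim (fun m => P.coeff m.1) (fun m => Q.coeff m.1)) (by
      simp only [monomialMultiples, Fintype.sum_sum_type, Sum.elim_inl, Sum.elim_inr,
        ← smul_mul_assoc, ← Finset.sum_mul]
      rw [sum_smul_monomial_eq hP, sum_smul_monomial_eq hQ, hPQ])
    constructor
    · rw [← sum_smul_monomial_eq hP]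
      exact Finset.sum_eq_zero fun m _ => smul_eq_zero_of_left (hcoeff (.inl m)) _
    · rw [← sum_smul_monomial_eq hQ]
      exact Finset.sum_eq_zero fun m _ => smul_eq_zero_of_left (hcoeff (.inr m)) _
  · intro h g hg
    obtain ⟨hP, hQ⟩ := h _ _ (totalDegree_sum_smul_monomial_lt hb₂ fun m => g (.inl m))
      (totalDegree_sum_smul_monomial_lt hb₁ fun m => g (.inr m)) (by
        simpa only [monomialMultiples, Fintype.sum_sum_type, Sum.elim_inl, Sum.elim_inr,
          ← smul_mul_assoc, ← Finset.sum_mul] using hg)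
    rintro (k | k)
    · rw [← coeff_sum_smul_monomial (fun m => g (.inl m)) k, hP, coeff_zero]
    · rw [← coeff_sum_smul_monomial (fun m => g (.inr m)) k, hQ, coeff_zero]

theorem linearIndependent_map_fractionRing {σ ι A : Type*} [Finite ι] [CommRing A]
    [IsDomain A] {v : ι → MvPolynomial σ A} (hv : LinearIndependent A v) :
    LinearIndependent (FractionRing A) (map (algebraMap A (FractionRing A)) ∘ v) := by
  have := Fintype.ofFinite ι
  rw [Fintype.linearIndependent_iff] at hv ⊢
  intro g hg
  obtain ⟨b, hb⟩ := IsLocalization.exist_integer_multiples_of_finite (nonZeroDivisors A) g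
  choose a ha using hb
  have hsum : ∑ i, a i • v i = 0 := by
    apply map_injective _ (IsFractionRing.injective A (FractionRing A))
    rw [map_zero, map_sum, ← smul_zero (algebraMap A (FractionRing A) b.1), ← hg, Finset.smul_sum]
    refine Finset.sum_congr rfl fun i _ => ?_
    rw [smul_eq_C_mul, map_mul, map_C, ha, Algebra.smul_def, smul_smul, smul_eq_C_mul]
    rfl
  intro i
  have := ha i
  rw [hv a hsum i, map_zero, eq_comm, Algebra.smul_def] at this
  exact (mul_eq_zero.1 this).resolve_left
    (IsFractionRing.to_map_ne_zero_of_mem_nonZeroDivisors b.2)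

/-- Linear independence of finitely many polynomials over a domain survives under specialization
of the coefficients away from a hypersurface. -/
theorem exists_forall_linearIndependent_map {σ ι A : Type*} [Finite ι] [CommRing A] [IsDomain A]
    {v : ι → MvPolynomial σ A} (hv : LinearIndependent A v) :
    ∃ d : A, d ≠ 0 ∧ ∀ {F : Type} [Field F] (φ : A →+* F), φ d ≠ 0 →
      LinearIndependent F (map φ ∘ v) := by
  classical
  have := Fintype.ofFinite ι
  let K := FractionRing A
  obtain ⟨L, hL⟩ := LinearMap.exists_leftInverse_of_injective
    (Fintype.linearCombination K (map (algebraMap A K) ∘ v))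
    (LinearMap.ker_eq_bot.2 (linearIndependent_iff_injective_fintypeLinearCombination.1
      (linearIndependent_map_fractionRing hv)))
  let T := Finset.univ.biUnion fun i => (v i).support
  obtain ⟨b, hb⟩ := IsLocalization.exist_integer_multiples_of_finite (nonZeroDivisors A)
    fun p : T × ι => L (monomial p.1.1 1) p.2
  choose N hN using hb
  have hvsum : ∀ i, ∑ m : T, (v i).coeff m.1 • monomial m.1 (1 : A) = v i := by
    intro i
    rw [Finset.sum_coe_sort T fun m => (v i).coeff m • monomial m (1 : A)]
    conv_rhs => rw [(v i).as_sum]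
    rw [← Finset.sum_subset (Finset.subset_biUnion_of_mem (fun i => (v i).support)
      (Finset.mem_univ i))]
    · simp [smul_monomial]
    · intro m _ hm
      rw [notMem_support_iff.1 hm, zero_smul]
  have hNv : ∀ i j, ∑ m : T, N (m, j) * (v i).coeff m.1 = if i = j then b.1 else 0 := by
    intro i j
    apply IsFractionRing.injective A K
    have h1 : L (map (algebraMap A K) (v i)) j = if i = j then 1 else 0 := by
      have := congrFun (LinearMap.congr_fun hL (Pi.single i 1)) j
      simpa [Fintype.linearCombination_apply_single, Pi.single_apply, eq_comm] using this
    rw [← hvsum i] at h1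
    simp only [map_sum, smul_eq_C_mul, map_mul, map_C, map_monomial, map_one] at h1
    simp only [← smul_eq_C_mul, map_smul, Finset.sum_apply, Pi.smul_apply, smul_eq_mul] at h1
    rw [map_sum]
    calc _ = algebraMap A K b.1 *
          ∑ m : T, algebraMap A K ((v i).coeff m.1) * L (monomial m.1 1) j := by
          rw [Finset.mul_sum]
          refine Finset.sum_congr rfl fun m _ => ?_
          rw [map_mul, hN, Algebra.smul_def]
          ring
      _ = _ := by rw [h1]; split_ifs <;> simp
  refine ⟨b.1, nonZeroDivisors.ne_zero b.2, fun {F} _ φ hφ => ?_⟩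
  rw [Fintype.linearIndependent_iff]
  intro g hg j
  have hcoeff : ∀ m : T, ∑ i, g i * φ ((v i).coeff m.1) = 0 := by
    intro m
    simpa [coeff_sum, coeff_map] using congrArg (coeff m.1) hg
  have : ∑ i, g i * φ (∑ m : T, N (m, j) * (v i).coeff m.1) = 0 := by
    calc _ = ∑ m : T, φ (N (m, j)) * ∑ i, g i * φ ((v i).coeff m.1) := by
          simp only [map_sum, map_mul, Finset.mul_sum]
          rw [Finset.sum_comm]
          exact Finset.sum_congr rfl fun _ _ => Finset.sum_congr rfl fun _ _ => by ring
      _ = 0 := by simp [hcoeff]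
  simp only [hNv, apply_ite φ, map_zero, mul_ite, mul_zero, Finset.sum_ite_eq',
    Finset.mem_univ, if_true] at this
  exact (mul_eq_zero.1 this).resolve_right hφ

/-- Two polynomials of positive degree over a field without syzygies of small degree are nonzero
and have no common nonconstant factor. -/
theorem totalDegree_eq_zero_of_dvd_of_dvd {σ F : Type*} [Field F] {f₁ f₂ : MvPolynomial σ F}
    {b₁ b₂ : ℕ} (hb₁ : 0 < b₁) (hb₂ : 0 < b₂)
    (hf₁ : f₁.totalDegree ≤ b₁) (hf₂ : f₂.totalDegree ≤ b₂)
    (h : ∀ P Q : MvPolynomial σ F, P.totalDegree < b₂ → Q.totalDegree < b₁ →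
      P * f₁ + Q * f₂ = 0 → P = 0 ∧ Q = 0) :
    f₁ ≠ 0 ∧ f₂ ≠ 0 ∧ ∀ c, c ∣ f₁ → c ∣ f₂ → c.totalDegree = 0 := by
  have h₁ : f₁ ≠ 0 := by
    rintro rfl
    exact one_ne_zero (h 1 0 (by simpa) (by simpa) (by simp)).1
  have h₂ : f₂ ≠ 0 := by
    rintro rfl
    exact one_ne_zero (h 0 1 (by simpa) (by simpa) (by simp)).2
  refine ⟨h₁, h₂, ?_⟩
  rintro c ⟨g₁, rfl⟩ ⟨g₂, rfl⟩
  by_contra hc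
  rw [totalDegree_mul_of_isDomain (left_ne_zero_of_mul h₁) (right_ne_zero_of_mul h₁)] at hf₁
  rw [totalDegree_mul_of_isDomain (left_ne_zero_of_mul h₂) (right_ne_zero_of_mul h₂)] at hf₂
  exact right_ne_zero_of_mul h₂
    (h g₂ (-g₁) (by omega) (by rw [totalDegree_neg]; omega) (by ring)).1

theorem eq_zero_of_mul_add_mul_eq_zero {σ A : Type*} [CommRing A] [IsDomain A]
    {H₁ H₂ P Q : MvPolynomial σ A} (h₁ : Prime H₁) (h₁₂ : ¬ H₁ ∣ H₂)
    (hQ : Q.totalDegree < H₁.totalDegree) (h : P * H₁ + Q * H₂ = 0) : P = 0 ∧ Q = 0 := by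
  have hdvd : H₁ ∣ Q :=
    (h₁.dvd_or_dvd ⟨-P, by linear_combination h⟩).resolve_right h₁₂
  have hQ0 : Q = 0 := by
    obtain ⟨R, rfl⟩ := hdvd
    by_contra hne
    rw [totalDegree_mul_of_isDomain h₁.ne_zero (right_ne_zero_of_mul hne)] at hQ
    omega
  subst hQ0
  exact ⟨(mul_eq_zero.1 (by simpa using h)).resolve_right h₁.ne_zero, rfl⟩

/-- Generic specializations of two polynomials without common factor have no common factor. -/
theorem exists_forall_map_no_common_factor {σ A : Type*} [Finite σ] [CommRing A] [IsDomain A]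
    {H₁ H₂ : MvPolynomial σ A} (h₁ : Prime H₁) (h₁₂ : ¬ H₁ ∣ H₂)
    (hd₁ : 0 < H₁.totalDegree) (hd₂ : 0 < H₂.totalDegree) :
    ∃ d : A, d ≠ 0 ∧ ∀ {F : Type} [Field F] (φ : A →+* F), φ d ≠ 0 →
      map φ H₁ ≠ 0 ∧ map φ H₂ ≠ 0 ∧
        ∀ c, c ∣ map φ H₁ → c ∣ map φ H₂ → c.totalDegree = 0 := by
  have hli : LinearIndependent A
      (monomialMultiples H₁ H₂ H₁.totalDegree H₂.totalDegree) :=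
    (linearIndependent_monomialMultiples_iff H₁ H₂ hd₁ hd₂).2
      fun P Q _ hQ h => eq_zero_of_mul_add_mul_eq_zero h₁ h₁₂ hQ h
  obtain ⟨d, hd, hdφ⟩ := exists_forall_linearIndependent_map hli
  refine ⟨d, hd, fun {F} _ φ hφ => ?_⟩
  have hliφ := hdφ φ hφ
  rw [map_comp_monomialMultiples] at hliφ
  exact totalDegree_eq_zero_of_dvd_of_dvd hd₁ hd₂
    (Finset.sup_mono (support_map_subset φ H₁))
    (Finset.sup_mono (support_map_subset φ H₂))
    ((linearIndependent_monomialMultiples_iff _ _ hd₁ hd₂).1 hliφ)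

/-- A polynomial in `x` and `y`, regarded as a polynomial in `y` with coefficients in `ℂ[x]`. -/
def overX (n : ℕ) :
    MvPolynomial (Fin n ⊕ Fin n) ℂ ≃ₐ[ℂ] MvPolynomial (Fin n) (MvPolynomial (Fin n) ℂ) :=
  (renameEquiv ℂ (Equiv.sumComm _ _)).trans (sumAlgEquiv ℂ _ _)

theorem sectionPoly_eq_map_overX {n : ℕ} (F : MvPolynomial (Fin n ⊕ Fin n) ℂ) (u : Fin n → ℂ) :
    sectionPoly F u = map (eval u) (overX n F) := by
  have : aeval (Sum.elim (fun i => C (u i)) X) =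
      ((mapAlgHom (aeval u)).comp (overX n).toAlgHom :
        MvPolynomial (Fin n ⊕ Fin n) ℂ →ₐ[ℂ] MvPolynomial (Fin n) ℂ) := by
    ext1 (i | i) <;> simp [overX]
  exact DFunLike.congr_fun this F

theorem totalDegree_overX_pos {n : ℕ} {F : MvPolynomial (Fin n ⊕ Fin n) ℂ} (hF : 0 < ydeg F) :
    0 < (overX n F).totalDegree := by
  rw [Nat.pos_iff_ne_zero]
  intro h
  rw [totalDegree_eq_zero_iff_eq_C] at h
  have hrename : ∀ a, overX n (rename Sum.inl a) = C a := by
    intro a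
    have : (overX n).toAlgHom.comp (rename Sum.inl) =
        IsScalarTower.toAlgHom ℂ (MvPolynomial (Fin n) ℂ)
          (MvPolynomial (Fin n) (MvPolynomial (Fin n) ℂ)) := by
      ext1 i
      simp [overX, algebraMap_eq]
    exact DFunLike.congr_fun this a
  rw [← hrename, EmbeddingLike.apply_eq_iff_eq] at h
  rw [h, ydeg, weightedTotalDegree_rename_of_injective Sum.inl_injective] at hF
  have : wy n ∘ Sum.inl = 0 := rfl
  simp [this, weightedTotalDegree, Finsupp.weight_apply] at hF

theorem MvPolynomial.IsWeightedHomogeneous.aeval_pow_smul {σ R S : Type*} [CommRing R] [CommRing S]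
    [Algebra R S] {w : σ → ℕ} {n : ℕ} {F : MvPolynomial σ R} (hF : F.IsWeightedHomogeneous w n)
    (t : R) (f : σ → S) : aeval (fun i => t ^ w i • f i) F = t ^ n • aeval f F := by
  rw [F.as_sum, map_sum, map_sum, Finset.smul_sum]
  refine Finset.sum_congr rfl fun m hm => ?_
  rw [aeval_monomial, aeval_monomial, ← hF (mem_support_iff.1 hm), Finsupp.weight_apply,
    Finsupp.prod, Finsupp.prod, Finsupp.sum, ← Finset.prod_pow_eq_pow_sum]
  simp only [Algebra.smul_def, mul_pow, Finset.prod_mul_distrib, map_prod, map_pow,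
    ← pow_mul, mul_comm (w _)]
  exact mul_left_comm _ _ _

theorem sectionPoly_smul {n a : ℕ} {F : MvPolynomial (Fin n ⊕ Fin n) ℂ}
    (hF : F.IsWeightedHomogeneous (wx n) a) (t : ℂ) (u : Fin n → ℂ) :
    sectionPoly F (t • u) = t ^ a • sectionPoly F u := by
  rw [sectionPoly, sectionPoly, ← hF.aeval_pow_smul]
  congr 2
  ext1 (i | i) <;> simp [wx, smul_eq_C_mul]

theorem eval_homogeneousComponent_smul {n : ℕ} (d : MvPolynomial (Fin n) ℂ) (i : ℕ) (t : ℂ)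
    (u : Fin n → ℂ) : eval (t • u) (homogeneousComponent i d) =
      t ^ i * eval u (homogeneousComponent i d) := by
  have := (homogeneousComponent_isHomogeneous i d).aeval_pow_smul t u
  simp only [Pi.one_apply, pow_one, smul_eq_mul] at this
  exact this

/-- The points having a representative at which `d` does not vanish form a Zariski-open set. -/
theorem zarOpen_setOf_exists_eval_ne_zero {n : ℕ} (d : MvPolynomial (Fin n) ℂ) :
    ZarOpen {p : Pt n | ∃ t : ℂ, t ≠ 0 ∧ eval (t • p.rep) d ≠ 0} := by
  classical
  refine ⟨(Finset.range (d.totalDegree + 1)).image fun i => homogeneousComponent i d, ?_, ?_⟩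
  · simp only [Finset.mem_image, forall_exists_index, and_imp]
    rintro _ i _ rfl
    exact ⟨i, homogeneousComponent_isHomogeneous i d⟩
  ext p
  have hsum : ∀ t : ℂ, eval (t • p.rep) d =
      ∑ i ∈ Finset.range (d.totalDegree + 1), t ^ i * eval p.rep (homogeneousComponent i d) := by
    intro t
    conv_lhs => rw [← sum_homogeneousComponent d, map_sum]
    exact Finset.sum_congr rfl fun i _ => eval_homogeneousComponent_smul d i t _
  simp only [Set.mem_ofPred_eq, Finset.forall_mem_image]
  constructor
  · rintro ⟨t, -, ht⟩ h
    rw [hsum, Finset.sum_eq_zero fun i hi => by rw [h hi, mul_zero]] at ht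
    exact ht rfl
  · intro h
    by_contra! hvan
    apply h
    let q : Polynomial ℂ := ∑ i ∈ Finset.range (d.totalDegree + 1),
      Polynomial.monomial i (eval p.rep (homogeneousComponent i d))
    have hq : Polynomial.X * q = 0 := by
      refine Polynomial.funext fun t => ?_
      by_cases ht : t = 0
      · simp [ht]
      · have := hvan t ht
        rw [hsum] at this
        rw [Polynomial.eval_mul, Polynomial.eval_finsetSum]
        simp only [Polynomial.eval_monomial, mul_comm _ (t ^ _), this, mul_zero,
          Polynomial.eval_zero]
    have hq0 : q = 0 := (mul_eq_zero.1 hq).resolve_left Polynomial.X_ne_zero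
    intro i hi
    have := congrArg (Polynomial.coeff · i) hq0
    simpa [q, Polynomial.finsetSum_coeff, Polynomial.coeff_monomial, Finset.mem_range.1 hi]
      using this

theorem exists_ne_zero_eval_ne_zero {n : ℕ} [NeZero n] {d : MvPolynomial (Fin n) ℂ} (hd : d ≠ 0) :
    ∃ w : Fin n → ℂ, w ≠ 0 ∧ eval w d ≠ 0 := by
  by_contra! h
  refine mul_ne_zero hd (X_ne_zero (0 : Fin n)) (MvPolynomial.funext fun w => ?_)
  by_cases hw : w = 0
  · simp [hw]
  · simp [h w hw]

/-- first part of Lemma 4.4 of the paper.  If `h₁, h₂` are irreducible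
bihomogeneous polynomials in `x₀,x₁,x₂,y₀,y₁,y₂`, not scalar multiples of each other, each of
positive degree in the `x`-variables and in the `y`-variables, then for `u` in a nonempty
Zariski-open subset of `ℙ²` (and any representative of `u`) the substituted polynomials
`h₁(u,·), h₂(u,·) ∈ ℂ[y₀,y₁,y₂]` are nonzero with no common nonconstant factor. -/
theorem stmt5
    (h₁ h₂ : MvPolynomial (Fin 3 ⊕ Fin 3) ℂ)
    (h₁irr : Irreducible h₁) (h₂irr : Irreducible h₂)
    (h₁bh : Bihom h₁) (h₂bh : Bihom h₂)
    (h₁x : 0 < xdeg h₁) (h₁y : 0 < ydeg h₁)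
    (h₂x : 0 < xdeg h₂) (h₂y : 0 < ydeg h₂)
    (hns : ∀ c : ℂ, h₂ ≠ c • h₁) :
    ∃ U : Set (Pt 3), ZarOpen U ∧ U.Nonempty ∧
      ∀ u ∈ U, ∀ (w : Fin 3 → ℂ) (hw : w ≠ 0), Projectivization.mk ℂ w hw = u →
        sectionPoly h₁ w ≠ 0 ∧ sectionPoly h₂ w ≠ 0 ∧
          ∀ c : MvPolynomial (Fin 3) ℂ,
            c ∣ sectionPoly h₁ w → c ∣ sectionPoly h₂ w → c.totalDegree = 0 := by
  have hdvd : ¬ h₁ ∣ h₂ := by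
    intro h
    obtain ⟨v, hv⟩ := h₁irr.associated_of_dvd h₂irr h
    obtain ⟨c, -, hc⟩ := isUnit_iff_eq_C_of_isReduced.1 v.isUnit
    exact hns c (by rw [← hv, hc, smul_eq_C_mul, mul_comm])
  have hprime : Prime (overX 3 h₁) :=
    (MulEquiv.prime_iff (overX 3)).2 h₁irr.prime
  obtain ⟨d, hd, hdφ⟩ := exists_forall_map_no_common_factor hprime
    (fun h => hdvd ((map_dvd_iff (overX 3)).1 h))
    (totalDegree_overX_pos h₁y) (totalDegree_overX_pos h₂y)
  refine ⟨_, zarOpen_setOf_exists_eval_ne_zero d, ?_, ?_⟩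
  · obtain ⟨w, hw, hdw⟩ := exists_ne_zero_eval_ne_zero hd
    obtain ⟨a, ha⟩ := Projectivization.exists_smul_eq_mk_rep ℂ w hw
    refine ⟨Projectivization.mk ℂ w hw, (a⁻¹ : ℂˣ), Units.ne_zero _, ?_⟩
    rwa [← ha, ← Units.smul_def, inv_smul_smul]
  · rintro _ ⟨t, ht, hdt⟩ w hw rfl
    obtain ⟨a, ha⟩ := Projectivization.exists_smul_eq_mk_rep ℂ w hw
    rw [← ha, Units.smul_def, smul_smul] at hdt
    obtain ⟨a₁, -, hx₁, -⟩ := h₁bh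
    obtain ⟨a₂, -, hx₂, -⟩ := h₂bh
    obtain ⟨hs₁, hs₂, hs⟩ := hdφ (eval ((t * a) • w)) hdt
    rw [← sectionPoly_eq_map_overX, sectionPoly_smul hx₁] at hs₁ hs
    rw [← sectionPoly_eq_map_overX, sectionPoly_smul hx₂] at hs₂ hs
    exact ⟨right_ne_zero_of_smul hs₁, right_ne_zero_of_smul hs₂,
      fun c hc₁ hc₂ => hs c (hc₁.trans (Dvd.intro_left _ (smul_eq_C_mul _ _).symm))
        (hc₂.trans (Dvd.intro_left _ (smul_eq_C_mul _ _).symm))⟩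
end
end
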